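/- arXiv:2506.19245 — 5 statements merged into one kernel-verified Lean document; each statement's English description precedes it below -/
import Mathlib

section
/- Let κ > 0 and define the Gaussian kernel k(x,y) = exp(−‖x−y‖²/(2κ²)) on ℝⁿ. Then k is C₀-universal: for every continuous function g : ℝⁿ → ℂ vanishing at infinity and every ε > 0, there exist p ≥ 1, points x₁, …, x_p ∈ ℝⁿ and coefficients a₁, …, a_p ∈ ℂ such that sup_{x ∈ ℝⁿ} |g(x) − ∑_{j=1}^p a_j exp(−‖x − x_j‖²/(2κ²))| < ε. -/
open Complex Real Finset

section GaussUniv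

variable {E : Type*} [NormedAddCommGroup E] [InnerProductSpace ℝ E]

/-- Linear span of the translates of the Gaussian `exp (-s ‖x‖²)`. -/
noncomputable def gSpan (E : Type*) [NormedAddCommGroup E] [InnerProductSpace ℝ E] (s : ℝ) :
    Submodule ℂ (E → ℂ) :=
  Submodule.span ℂ (Set.range fun c : E => fun y : E => ((Real.exp (-(s * ‖y - c‖ ^ 2)) : ℝ) : ℂ))

/-- Uniform closure of the span. -/
noncomputable def gClos (E : Type*) [NormedAddCommGroup E] [InnerProductSpace ℝ E] (s : ℝ) :
    Submodule ℂ (E → ℂ) where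
  carrier := {f | ∀ ε : ℝ, 0 < ε → ∃ g ∈ gSpan E s, ∀ y, ‖f y - g y‖ ≤ ε}
  zero_mem' := fun ε hε => ⟨0, zero_mem _, fun y => by simpa using hε.le⟩
  add_mem' := by
    intro f₁ f₂ h₁ h₂ ε hε
    obtain ⟨g₁, hg₁, k₁⟩ := h₁ (ε / 2) (by positivity)
    obtain ⟨g₂, hg₂, k₂⟩ := h₂ (ε / 2) (by positivity)
    refine ⟨g₁ + g₂, add_mem hg₁ hg₂, fun y => ?_⟩
    have := norm_add_le (f₁ y - g₁ y) (f₂ y - g₂ y)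
    have e : (f₁ + f₂) y - (g₁ + g₂) y = (f₁ y - g₁ y) + (f₂ y - g₂ y) := by
      simp only [Pi.add_apply]; ring
    rw [e]
    linarith [k₁ y, k₂ y]
  smul_mem' := by
    intro c f h ε hε
    obtain ⟨g, hg, k⟩ := h (ε / (‖c‖ + 1)) (by positivity)
    refine ⟨c • g, Submodule.smul_mem _ _ hg, fun y => ?_⟩
    have e : (c • f) y - (c • g) y = c * (f y - g y) := by
      simp only [Pi.smul_apply, smul_eq_mul]; ring
    rw [e, norm_mul]
    calc ‖c‖ * ‖f y - g y‖ ≤ (‖c‖ + 1) * (ε / (‖c‖ + 1)) := by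
          gcongr
          · linarith
          · exact k y
      _ = ε := by field_simp

lemma gClos_closed (s : ℝ) (f : E → ℂ)
    (h : ∀ ε : ℝ, 0 < ε → ∃ g ∈ gClos E s, ∀ y, ‖f y - g y‖ ≤ ε) : f ∈ gClos E s := by
  intro ε hε
  obtain ⟨g, hg, k⟩ := h (ε / 2) (by positivity)
  obtain ⟨g', hg', k'⟩ := hg (ε / 2) (by positivity)
  refine ⟨g', hg', fun y => ?_⟩
  have := norm_sub_le_norm_sub_add_norm_sub (f y) (g y) (g' y)
  linarith [k y, k' y]

lemma gClos_exp (s : ℝ) (hs : 0 < s) (c : E) :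
    (fun y : E => ((Real.exp (-(s * ‖y‖ ^ 2)) * Real.exp (inner ℝ y c) : ℝ) : ℂ)) ∈ gClos E s := by
  intro ε hε
  refine ⟨_, Submodule.smul_mem _ ((Real.exp (s * ‖(1 / (2 * s)) • c‖ ^ 2) : ℝ) : ℂ)
    (Submodule.subset_span ⟨(1 / (2 * s)) • c, rfl⟩), fun y => ?_⟩
  have : Real.exp (-(s * ‖y‖ ^ 2)) * Real.exp (inner ℝ y c) =
      Real.exp (s * ‖(1 / (2 * s)) • c‖ ^ 2) * Real.exp (-(s * ‖y - (1 / (2 * s)) • c‖ ^ 2)) := by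
    rw [← Real.exp_add, ← Real.exp_add, norm_sub_sq_real, inner_smul_right]
    congr 1
    field_simp
    ring
  simp only [Pi.smul_apply, smul_eq_mul]
  rw [this]
  push_cast
  simp [hε.le]

lemma gauss_bound (s : ℝ) (hs : 0 < s) (c : E) (A : ℝ) (hA : 0 ≤ A) :
    ∃ C : ℝ, 0 < C ∧ ∀ y : E, Real.exp (-(s * ‖y‖ ^ 2)) * Real.exp (A * |inner ℝ y c|) ≤ C := by
  refine ⟨Real.exp ((A * ‖c‖) ^ 2 / (4 * s)), Real.exp_pos _, fun y => ?_⟩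
  rw [← Real.exp_add]
  apply Real.exp_le_exp.mpr
  have h1 : |inner ℝ y c| ≤ ‖y‖ * ‖c‖ := abs_real_inner_le_norm y c
  have h2 : A * |inner ℝ y c| ≤ A * (‖y‖ * ‖c‖) := by gcongr
  have h3 : (A * ‖c‖) ^ 2 / (4 * s) + s * ‖y‖ ^ 2 - A * (‖y‖ * ‖c‖)
      = (2 * s * ‖y‖ - A * ‖c‖) ^ 2 / (4 * s) := by
    field_simp; ring
  have h4 : 0 ≤ (2 * s * ‖y‖ - A * ‖c‖) ^ 2 / (4 * s) := by positivity
  linarith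

lemma abs_pow_le_exp (u : ℝ) (k : ℕ) : |u| ^ k ≤ (k.factorial : ℝ) * Real.exp |u| := by
  have := Real.pow_div_factorial_le_exp _ (abs_nonneg u) k
  rw [div_le_iff₀ (by positivity)] at this
  linarith

lemma exp_diff_bound (u h : ℝ) (h0 : 0 < h) (h1 : h ≤ 1) :
    |u - (Real.exp (h * u) - 1) / h| ≤ h * (|u| ^ 2 * Real.exp |u|) := by
  have key := Complex.norm_exp_sub_sum_le_norm_mul_exp ((h * u : ℝ) : ℂ) 2
  have e : Complex.exp ((h * u : ℝ) : ℂ) - ∑ m ∈ range 2, ((h * u : ℝ) : ℂ) ^ m / (m.factorial : ℂ)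
      = ((Real.exp (h * u) - 1 - h * u : ℝ) : ℂ) := by
    simp [Finset.sum_range_succ]; ring
  rw [e, Complex.norm_real, Complex.norm_real, Real.norm_eq_abs, Real.norm_eq_abs, abs_mul,
    abs_of_pos h0] at key
  have e2 : u - (Real.exp (h * u) - 1) / h = -(Real.exp (h * u) - 1 - h * u) / h := by
    field_simp; ring
  rw [e2, abs_div, abs_neg, abs_of_pos h0, div_le_iff₀ h0]
  refine key.trans ?_
  have : Real.exp (h * |u|) ≤ Real.exp |u| := by
    apply Real.exp_le_exp.mpr
    nlinarith [abs_nonneg u]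
  calc (h * |u|) ^ 2 * Real.exp (h * |u|) ≤ (h * |u|) ^ 2 * Real.exp |u| := by gcongr
    _ = _ := by ring

lemma gClos_pow (s : ℝ) (hs : 0 < s) (c : E) (k : ℕ) : ∀ t : ℝ,
    (fun y : E => ((Real.exp (-(s * ‖y‖ ^ 2)) * ((inner ℝ y c) ^ k *
      Real.exp (t * inner ℝ y c)) : ℝ) : ℂ)) ∈ gClos E s := by
  induction k with
  | zero =>
    intro t
    have := gClos_exp s hs (t • c)
    simpa [inner_smul_right] using this
  | succ k ih =>
    intro t
    apply gClos_closed
    intro ε hε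
    obtain ⟨C, hC, hb⟩ := gauss_bound s hs c (|t| + 2) (by positivity)
    set D : ℝ := ((k + 2).factorial : ℝ) * C with hD
    have hDpos : 0 < D := by positivity
    set h : ℝ := min 1 (ε / D) with hh
    have h0 : 0 < h := by positivity
    have h1 : h ≤ 1 := min_le_left _ _
    have h2 : h * D ≤ ε := by
      have : h ≤ ε / D := min_le_right _ _
      rwa [le_div_iff₀ hDpos] at this
    refine ⟨_, Submodule.smul_mem _ ((1 / h : ℝ) : ℂ) (sub_mem (ih (t + h)) (ih t)), fun y => ?_⟩
    simp only [Pi.smul_apply, Pi.sub_apply, smul_eq_mul]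
    rw [← Complex.ofReal_sub, ← Complex.ofReal_mul, ← Complex.ofReal_sub, Complex.norm_real,
      Real.norm_eq_abs]
    set u : ℝ := inner ℝ y c with hu
    set w : ℝ := Real.exp (-(s * ‖y‖ ^ 2)) with hw
    have hw0 : 0 < w := Real.exp_pos _
    have e : w * (u ^ (k + 1) * Real.exp (t * u)) - 1 / h * (w * (u ^ k * Real.exp ((t + h) * u)) -
        w * (u ^ k * Real.exp (t * u))) =
        w * (u ^ k * Real.exp (t * u)) * (u - (Real.exp (h * u) - 1) / h) := by
      rw [add_mul, Real.exp_add]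
      field_simp
      ring
    rw [e, abs_mul, abs_mul, abs_mul, abs_pow, abs_of_pos hw0, Real.abs_exp]
    have b1 := exp_diff_bound u h h0 h1
    have b2 := abs_pow_le_exp u (k + 2)
    have b3 : Real.exp (t * u) ≤ Real.exp (|t| * |u|) := by
      apply Real.exp_le_exp.mpr
      rw [← abs_mul]; exact le_abs_self _
    have b4 := hb y
    rw [← hw, ← hu] at b4
    calc w * (|u| ^ k * Real.exp (t * u)) * |u - (Real.exp (h * u) - 1) / h|
        ≤ w * (|u| ^ k * Real.exp (|t| * |u|)) * (h * (|u| ^ 2 * Real.exp |u|)) := by gcongr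
      _ = h * w * Real.exp (|t| * |u|) * Real.exp |u| * |u| ^ (k + 2) := by ring
      _ ≤ h * w * Real.exp (|t| * |u|) * Real.exp |u| *
          (((k + 2).factorial : ℝ) * Real.exp |u|) := by gcongr
      _ = h * ((k + 2).factorial : ℝ) * (w * Real.exp ((|t| + 2) * |u|)) := by
          rw [show (|t| + 2) * |u| = |t| * |u| + |u| + |u| by ring, Real.exp_add, Real.exp_add]
          ring
      _ ≤ h * ((k + 2).factorial : ℝ) * C := by gcongr
      _ = h * D := by rw [hD]; ring
      _ ≤ ε := h2

lemma exp_tail_bound (x : ℝ) (hx : 0 ≤ x) (N : ℕ) :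
    Real.exp x - ∑ m ∈ range N, x ^ m / m.factorial ≤ (1 / 2) ^ N * Real.exp (2 * x) := by
  have hs : ∀ z : ℝ, HasSum (fun m : ℕ => z ^ m / (m.factorial : ℝ)) (Real.exp z) := by
    intro z
    rw [Real.exp_eq_exp_ℝ]
    exact NormedSpace.expSeries_div_hasSum_exp z
  have h1 := (hasSum_nat_add_iff' N).mpr (hs x)
  have h2 := ((hasSum_nat_add_iff' N).mpr (hs (2 * x))).mul_left ((1 / 2 : ℝ) ^ N)
  have h3 := hasSum_le (fun m => ?_) h1 h2
  · refine h3.trans ?_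
    gcongr
    have : 0 ≤ ∑ m ∈ range N, (2 * x) ^ m / (m.factorial : ℝ) :=
      Finset.sum_nonneg fun i _ => by positivity
    linarith
  · have : (1 / 2 : ℝ) ^ N * ((2 * x) ^ (m + N) / ((m + N).factorial : ℝ)) =
        2 ^ m * (x ^ (m + N) / ((m + N).factorial : ℝ)) := by
      rw [mul_pow, pow_add 2, one_div, inv_pow]
      field_simp
    rw [this]
    have h5 : (1 : ℝ) ≤ 2 ^ m := one_le_pow₀ (by norm_num)
    exact le_mul_of_one_le_left (by positivity) h5

lemma gClos_char (s : ℝ) (hs : 0 < s) (c : E) :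
    (fun y : E => ((Real.exp (-(s * ‖y‖ ^ 2)) : ℝ) : ℂ) * Complex.exp ((inner ℝ y c : ℝ) * I))
      ∈ gClos E s := by
  apply gClos_closed
  intro ε hε
  obtain ⟨C, hC, hb⟩ := gauss_bound s hs c 2 (by positivity)
  obtain ⟨N, hN⟩ := exists_pow_lt_of_lt_one (show 0 < ε / C by positivity)
    (show (1 / 2 : ℝ) < 1 by norm_num)
  rw [lt_div_iff₀ hC] at hN
  refine ⟨∑ m ∈ range N, (I ^ m / (m.factorial : ℂ)) • _,
    Submodule.sum_mem _ fun m _ => Submodule.smul_mem _ _ (gClos_pow s hs c m 0), fun y => ?_⟩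
  simp only [Finset.sum_apply, Pi.smul_apply, smul_eq_mul, zero_mul, Real.exp_zero, mul_one]
  set u : ℝ := inner ℝ y c with hu
  set w : ℝ := Real.exp (-(s * ‖y‖ ^ 2)) with hw
  have hw0 : 0 < w := Real.exp_pos _
  have e : (w : ℂ) * Complex.exp (u * I) - ∑ m ∈ range N, I ^ m / (m.factorial : ℂ) *
      ((w * u ^ m : ℝ) : ℂ) = w * (Complex.exp (u * I) - ∑ m ∈ range N,
        (u * I) ^ m / (m.factorial : ℂ)) := by
    rw [mul_sub, Finset.mul_sum]
    congr 1
    refine Finset.sum_congr rfl fun m _ => ?_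
    push_cast
    ring
  rw [e, norm_mul, Complex.norm_real, Real.norm_eq_abs, abs_of_pos hw0]
  have b1 := Complex.norm_exp_sub_sum_le_exp_norm_sub_sum (u * I) N
  have nu : ‖(u : ℂ) * I‖ = |u| := by simp
  rw [nu] at b1
  have b2 := exp_tail_bound |u| (abs_nonneg u) N
  have b3 := hb y
  calc _ ≤ w * ((1 / 2) ^ N * Real.exp (2 * |u|)) := by
        gcongr; exact b1.trans b2
    _ = (1 / 2) ^ N * (w * Real.exp (2 * |u|)) := by ring
    _ ≤ (1 / 2) ^ N * C := by gcongr
    _ ≤ ε := hN.le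

lemma bounded_approx {X : Type*} [TopologicalSpace X] {A : Subalgebra ℝ C(X, ℝ)}
    (hA : A.SeparatesPoints) (hB : ∀ r ∈ A, ∃ B : ℝ, ∀ x, |r x| ≤ B)
    (f : C(X, ℝ)) (M : ℝ) (hM : 0 ≤ M) (hf : ∀ x, |f x| ≤ M) {K : Set X} (hK : IsCompact K)
    {ε : ℝ} (hε : 0 < ε) :
    ∃ r ∈ A, (∀ x ∈ K, |r x - f x| ≤ ε) ∧ ∀ x, |r x| ≤ M + ε := by
  obtain ⟨p, hp, hpK⟩ :=
    ContinuousMap.exists_mem_subalgebra_near_continuous_of_isCompact_of_separatesPoints hA f hK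
      (show 0 < ε / 2 by positivity)
  obtain ⟨B, hB⟩ := hB p hp
  obtain ⟨q, hq⟩ := exists_polynomial_near_of_continuousOn (-B) B
    (fun t => max (-M) (min M t)) (by fun_prop) (ε / 2) (by positivity)
  refine ⟨Polynomial.aeval p q, by
    have : Polynomial.aeval p q = ((Polynomial.aeval (⟨p, hp⟩ : A) q : A) : C(X, ℝ)) := by
      rw [← Subalgebra.coe_val, ← Polynomial.aeval_algHom_apply]; rfl
    rw [this]; exact Subtype.mem _, ?_⟩
  have hev : ∀ x, (Polynomial.aeval p q) x = q.eval (p x) := by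
    intro x
    simp [Polynomial.aeval_continuousMap_apply]
  have hq' : ∀ x, |q.eval (p x) - max (-M) (min M (p x))| < ε / 2 :=
    fun x => hq (p x) (abs_le.mp (hB x))
  constructor
  · intro x hx
    rw [hev]
    have h1 := abs_lt.mp (hq' x)
    have h2 := hpK x hx
    rw [Real.norm_eq_abs, abs_lt] at h2
    have h3 := abs_le.mp (hf x)
    rw [abs_le]
    rcases max_cases (-M) (min M (p x)) with ⟨a, b⟩ | ⟨a, b⟩ <;>
    rcases min_cases M (p x) with ⟨a', b'⟩ | ⟨a', b'⟩ <;>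
    constructor <;> linarith
  · intro x
    rw [hev]
    have h1 := abs_lt.mp (hq' x)
    rw [abs_le]
    have h2 : -M ≤ max (-M) (min M (p x)) := le_max_left _ _
    have h3 : max (-M) (min M (p x)) ≤ M := max_le (by linarith) (min_le_left _ _)
    constructor <;> linarith

/-- Trigonometric polynomials on `E`. -/
noncomputable def trig (E : Type*) [NormedAddCommGroup E] [InnerProductSpace ℝ E] :
    StarSubalgebra ℂ C(E, ℂ) :=
  (BoundedContinuousFunction.charPoly (V := E) (W := E) continuous_probChar (L := innerₗ E)
    continuous_inner).map (BoundedContinuousFunction.toContinuousMapStarₐ ℂ)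

lemma trig_sep : (trig E).SeparatesPoints := by
  refine BoundedContinuousFunction.separatesPoints_charPoly continuous_probChar
    probChar_ne_one _ ?_
  exact fun v hv ↦ DFunLike.ne_iff.mpr ⟨v, inner_self_ne_zero.mpr hv⟩

lemma trig_bdd (f : C(E, ℂ)) (hf : f ∈ trig E) : ∃ B : ℝ, ∀ x, ‖f x‖ ≤ B := by
  obtain ⟨g, _, rfl⟩ := hf
  exact ⟨‖g‖, fun x => g.norm_coe_le_norm x⟩

lemma trig_mem (s : ℝ) (hs : 0 < s) (f : C(E, ℂ)) (hf : f ∈ trig E) :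
    (fun y : E => ((Real.exp (-(s * ‖y‖ ^ 2)) : ℝ) : ℂ) * f y) ∈ gClos E s := by
  obtain ⟨g, hg, rfl⟩ := hf
  obtain ⟨w, hw⟩ := (BoundedContinuousFunction.mem_charPoly g).mp hg
  have : (fun y : E => ((Real.exp (-(s * ‖y‖ ^ 2)) : ℝ) : ℂ) * g y) =
      ∑ a ∈ w.coeff.support, w.coeff a • (fun y : E => ((Real.exp (-(s * ‖y‖ ^ 2)) : ℝ) : ℂ) *
        Complex.exp ((inner ℝ y a : ℝ) * I)) := by
    funext y
    rw [hw]
    simp only [Finsupp.sum, Finset.sum_apply, Pi.smul_apply, smul_eq_mul, Finset.mul_sum,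
      probChar_apply, innerₗ_apply_apply]
    refine Finset.sum_congr rfl fun m _ => ?_
    ring
  change (fun y : E => ((Real.exp (-(s * ‖y‖ ^ 2)) : ℝ) : ℂ) * g y) ∈ gClos E s
  rw [this]
  exact Submodule.sum_mem _ fun m _ => Submodule.smul_mem _ _ (gClos_char s hs m)

lemma gClos_real [ProperSpace E] (s : ℝ) (hs : 0 < s) (h : E → ℝ) (hc : Continuous h)
    (h0 : ∀ ε : ℝ, 0 < ε → IsCompact {x : E | ε ≤ |h x|}) :
    (fun y : E => ((h y : ℝ) : ℂ)) ∈ gClos E s := by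
  apply gClos_closed
  intro ε hε
  set w : E → ℝ := fun y => Real.exp (-(s * ‖y‖ ^ 2)) with hw
  have hwc : Continuous w := by fun_prop
  have hw0 : ∀ y, 0 < w y := fun y => Real.exp_pos _
  have hw1 : ∀ y, w y ≤ 1 := fun y => Real.exp_le_one_iff.mpr (by
    have : 0 ≤ s * ‖y‖ ^ 2 := by positivity
    linarith)
  set η : ℝ := ε / 2 with hη
  have hη0 : 0 < η := by positivity
  let h1 : E → ℝ := fun y => h y - max (-η) (min η (h y))
  have h1c : Continuous h1 := by fun_prop
  have hd : ∀ y, |h y - h1 y| ≤ η := by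
    intro y
    have : h y - h1 y = max (-η) (min η (h y)) := by simp [h1]
    rw [this, abs_le]
    exact ⟨le_max_left _ _, max_le (by linarith) (min_le_left _ _)⟩
  have hz : ∀ y, y ∉ {x : E | η ≤ |h x|} → h1 y = 0 := by
    intro y hy
    simp only [Set.mem_ofPred_eq, not_le, abs_lt] at hy
    simp [h1, min_eq_right hy.2.le, max_eq_right hy.1.le]
  let f : C(E, ℝ) := ⟨fun y => h1 y / w y, h1c.div hwc fun y => (hw0 y).ne'⟩
  obtain ⟨M', hM'⟩ := (h0 η hη0).exists_bound_of_continuousOn (f := f) f.continuous.continuousOn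
  set M : ℝ := max M' 0 with hM
  have hM0 : 0 ≤ M := le_max_right _ _
  have hfM : ∀ x, |f x| ≤ M := by
    intro x
    by_cases hx : x ∈ {x : E | η ≤ |h x|}
    · exact (hM' x hx).trans (le_max_left _ _)
    · have : f x = 0 := by simp [f, hz x hx]
      rw [this]; simpa using hM0
  set δ : ℝ := η / (2 * M + 1) with hδ
  have hδ0 : 0 < δ := by positivity
  have hK : IsCompact {x : E | δ ≤ w x} := by
    refine Metric.isCompact_of_isClosed_isBounded (isClosed_le continuous_const hwc) ?_
    refine (Metric.isBounded_closedBall (x := (0 : E)) (r := -Real.log δ / s + 1)).subset ?_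
    intro x hx
    have hx' : Real.log δ ≤ -(s * ‖x‖ ^ 2) := (Real.log_le_iff_le_exp hδ0).mpr hx
    rw [mem_closedBall_zero_iff]
    have h2 : ‖x‖ ^ 2 ≤ -Real.log δ / s := by
      rw [le_div_iff₀ hs]; linarith
    nlinarith [sq_nonneg (‖x‖ - 1), sq_nonneg ‖x‖]
  obtain ⟨r, hrA, hrK, hrM⟩ := bounded_approx (Subalgebra.SeparatesPoints.rclike_to_real
    (𝕜 := ℂ) (trig_sep (E := E))) (fun r hr => by
      obtain ⟨B, hB⟩ := trig_bdd _ hr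
      exact ⟨B, fun x => by
        have h3 : ‖((r x : ℝ) : ℂ)‖ ≤ B := hB x
        rwa [Complex.norm_real, Real.norm_eq_abs] at h3⟩) f M hM0 hfM hK
    (show 0 < min η 1 by positivity)
  refine ⟨_, trig_mem s hs _ hrA, fun y => ?_⟩
  have e : ‖((h y : ℝ) : ℂ) - ((w y : ℝ) : ℂ) * ((r y : ℝ) : ℂ)‖ ≤ ε := by
    rw [← Complex.ofReal_mul, ← Complex.ofReal_sub, Complex.norm_real, Real.norm_eq_abs]
    have e1 : h1 y = w y * f y := by
      have := (hw0 y).ne'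
      simp only [f, ContinuousMap.coe_mk]; field_simp
    have e2 : h y - w y * r y = (h y - h1 y) - w y * (r y - f y) := by rw [e1]; ring
    have e3 : |w y * (r y - f y)| ≤ η := by
      rw [abs_mul, abs_of_pos (hw0 y)]
      by_cases hy : y ∈ {x : E | δ ≤ w x}
      · have := (hrK y hy).trans (min_le_left _ _)
        calc w y * |r y - f y| ≤ 1 * η := by gcongr; exact hw1 y
          _ = η := one_mul _
      · simp only [Set.mem_ofPred_eq, not_le] at hy
        have a1 := (hrM y).trans (add_le_add_right (min_le_right η 1) M)
        have a2 : |r y - f y| ≤ 2 * M + 1 := by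
          have := abs_sub (r y) (f y)
          linarith [hfM y]
        calc w y * |r y - f y| ≤ δ * (2 * M + 1) := by gcongr
          _ = η := by rw [hδ]; field_simp
    rw [e2]
    have := abs_sub (h y - h1 y) (w y * (r y - f y))
    linarith [hd y]
  exact e

lemma gClos_complex [ProperSpace E] (s : ℝ) (hs : 0 < s) (g : E → ℂ) (hg : Continuous g)
    (hg0 : ∀ ε : ℝ, 0 < ε → IsCompact {x : E | ε ≤ ‖g x‖}) : g ∈ gClos E s := by
  have h1 := gClos_real s hs (fun y => (g y).re) (by fun_prop) (fun ε hε =>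
    (hg0 ε hε).of_isClosed_subset (isClosed_le continuous_const (by fun_prop))
      fun x hx => le_trans hx (Complex.abs_re_le_norm _))
  have h2 := gClos_real s hs (fun y => (g y).im) (by fun_prop) (fun ε hε =>
    (hg0 ε hε).of_isClosed_subset (isClosed_le continuous_const (by fun_prop))
      fun x hx => le_trans hx (Complex.abs_im_le_norm _))
  have := add_mem h1 (Submodule.smul_mem _ I h2)
  convert this using 1
  funext y
  simp only [Pi.add_apply, Pi.smul_apply, smul_eq_mul]
  rw [mul_comm, Complex.re_add_im]

end GaussUniv

/-- For any length-scale `κ > 0`, the Gaussian kernel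
`k(x,y) = exp(-‖x-y‖²/(2κ²))` on `ℝⁿ` is `C₀`-universal: every continuous `g : ℝⁿ → ℂ`
vanishing at infinity (all its superlevel sets are compact) can be approximated uniformly on
`ℝⁿ`, to any accuracy `ε > 0`, by finite linear combinations of Gaussians centered at finitely
many points. -/
theorem gaussian_kernel_C0_universal
    {n : ℕ} (κ : ℝ) (hκ : 0 < κ)
    (g : EuclideanSpace ℝ (Fin n) → ℂ) (hg : Continuous g)
    (hg0 : ∀ ε : ℝ, 0 < ε → IsCompact {x : EuclideanSpace ℝ (Fin n) | ε ≤ ‖g x‖}) :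
    ∀ ε : ℝ, 0 < ε →
      ∃ (p : ℕ) (_ : 1 ≤ p) (x : Fin p → EuclideanSpace ℝ (Fin n)) (a : Fin p → ℂ),
        ∀ y : EuclideanSpace ℝ (Fin n),
          ‖g y - ∑ j : Fin p, a j *
            Complex.exp (-(((‖y - x j‖ ^ 2 / (2 * κ ^ 2) : ℝ)) : ℂ))‖ < ε := by
  intro ε hε
  have hs : 0 < 1 / (2 * κ ^ 2) := by positivity
  obtain ⟨f, hf, hfg⟩ := gClos_complex (1 / (2 * κ ^ 2)) hs g hg hg0 (ε / 2) (by positivity)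
  obtain ⟨m, a, v, hav⟩ := Submodule.mem_span_set'.mp hf
  choose c hc using fun i => (v i).2
  refine ⟨m + 1, by omega, Fin.cons 0 c, Fin.cons 0 a, fun y => ?_⟩
  have key : ∑ j : Fin (m + 1), (Fin.cons 0 a : Fin (m + 1) → ℂ) j *
      Complex.exp (-(((‖y - (Fin.cons 0 c : Fin (m + 1) → EuclideanSpace ℝ (Fin n)) j‖ ^ 2 /
        (2 * κ ^ 2) : ℝ)) : ℂ)) = f y := by
    rw [Fin.sum_univ_succ, ← hav, Finset.sum_apply]
    simp only [Fin.cons_zero, Fin.cons_succ, zero_mul, zero_add, Pi.smul_apply, smul_eq_mul]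
    refine Finset.sum_congr rfl fun j _ => ?_
    rw [← hc j]
    congr 1
    rw [← Complex.ofReal_neg, ← Complex.ofReal_exp]
    congr 3
    ring
  rw [key]
  linarith [hfg y]
end

section
/- Let κ > 0 and define the Laplacian kernel k(x,y) = exp(−‖x−y‖/κ) on ℝⁿ. Then k is C₀-universal: for every continuous function g : ℝⁿ → ℂ vanishing at infinity and every ε > 0, there exist p ≥ 1, points x₁, …, x_p ∈ ℝⁿ and coefficients a₁, …, a_p ∈ ℂ such that sup_{x ∈ ℝⁿ} |g(x) − ∑_{j=1}^p a_j exp(−‖x − x_j‖/κ)| < ε. -/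
open Complex Real Finset

open MeasureTheory Filter Topology
open scoped FourierTransform BoundedContinuousFunction

theorem ftc_Ioi {F f : ℝ → ℝ} {a b : ℝ} (hF : ∀ s ∈ Set.Ioi (0:ℝ), HasDerivAt F (f s) s)
    (hf : ∀ s ∈ Set.Ioi (0:ℝ), 0 ≤ f s) (h0 : Tendsto F (𝓝[>] 0) (𝓝 a))
    (h1 : Tendsto F atTop (𝓝 b)) : ∫ s in Set.Ioi (0:ℝ), f s = b - a := by
  rw [← Set.Ici_sdiff_left] at h0
  let G := Function.update F 0 a
  have hderiv : ∀ x ∈ Set.Ioi (0:ℝ), HasDerivAt G (f x) x := by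
    intro x hx
    apply (hF x hx).congr_of_eventuallyEq
    filter_upwards [eventually_ne_nhds (ne_of_gt hx)] with y hy
    exact Function.update_of_ne hy _ _
  have htendsto : Tendsto G atTop (𝓝 b) := by
    apply h1.congr'
    filter_upwards [eventually_ne_atTop 0] with x hx
    exact (Function.update_of_ne hx _ _).symm
  simpa [G] using integral_Ioi_of_hasDerivAt_of_nonneg
    (continuousWithinAt_update_same.mpr h0) hderiv hf htendsto

theorem subord (r : ℝ) (hr : 0 ≤ r) :
    ∫ s in Set.Ioi (0:ℝ), Real.exp (-π * s^2 - π * r^2 / s^2) = Real.exp (-(2 * π * r)) / 2 := by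
  rcases hr.eq_or_lt with rfl | hr
  · have := integral_gaussian_Ioi π
    simp at this ⊢
    exact this
  set e : ℝ → ℝ := fun t => Real.exp (-π * t^2) with he
  have hec : Continuous e := by fun_prop
  have hei : Integrable e := integrable_exp_neg_mul_sq Real.pi_pos
  have hval : ∫ t in Set.Ioi (0:ℝ), e t = 1/2 := by
    have := integral_gaussian_Ioi π
    simp at this
    simp [he, this]
  set E : ℝ → ℝ := fun x => ∫ t in (0:ℝ)..x, e t with hE
  have hEd : ∀ x, HasDerivAt E (e x) x := fun x =>
    intervalIntegral.integral_hasDerivAt_right (hec.intervalIntegrable _ _)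
      (hec.stronglyMeasurableAtFilter _ _) hec.continuousAt
  have hEtop : Tendsto E atTop (𝓝 (1/2)) := by
    rw [← hval]
    exact intervalIntegral_tendsto_integral_Ioi 0 hei.integrableOn tendsto_id
  have hEodd : ∀ x, E (-x) = - E x := by
    intro x
    have h := intervalIntegral.integral_comp_neg (a := 0) (b := x) e
    have h2 : (fun t => e (-t)) = e := by ext t; simp [he]
    simp only [h2, neg_zero] at h
    simp only [hE]
    rw [intervalIntegral.integral_symm, ← h]
  have hEbot : Tendsto E atBot (𝓝 (-(1/2))) := by
    have : E = fun x => - E (-x) := by ext x; rw [hEodd]; simp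
    rw [this]
    exact (hEtop.comp tendsto_neg_atBot_atTop).neg
  set A := Real.exp (2*π*r) with hA
  set B := Real.exp (-(2*π*r)) with hB
  have hinv0 : Tendsto (fun s : ℝ => r / s) (𝓝[>] 0) atTop := by
    simpa [div_eq_mul_inv] using tendsto_inv_nhdsGT_zero.const_mul_atTop hr
  have hid0 : Tendsto (fun s : ℝ => s) (𝓝[>] 0) (𝓝 0) := tendsto_id.mono_left nhdsWithin_le_nhds
  have hinv1 : Tendsto (fun s : ℝ => r / s) atTop (𝓝 0) := tendsto_const_nhds.div_atTop tendsto_id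
  have key := ftc_Ioi (F := fun s => A * E (s + r / s) + B * E (s - r / s))
    (f := fun s => 2 * Real.exp (-π * s^2 - π * r^2 / s^2))
    (a := A * (1/2) + B * (-(1/2))) (b := A * (1/2) + B * (1/2)) ?_ (fun s _ => by positivity) ?_ ?_
  · rw [integral_const_mul] at key
    linarith
  · intro s hs
    have hs : s ≠ 0 := ne_of_gt hs
    have hd : HasDerivAt (fun s : ℝ => r / s) (-r / s^2) s := by
      simpa [div_eq_mul_inv] using (hasDerivAt_inv hs).const_mul r
    have h1 := ((hEd (s + r/s)).comp s ((hasDerivAt_id s).add hd)).const_mul A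
    have h2 := ((hEd (s - r/s)).comp s ((hasDerivAt_id s).sub hd)).const_mul B
    refine (h1.add h2).congr_deriv ?_
    have e1 : A * e (s + r/s) = Real.exp (-π * s^2 - π * r^2 / s^2) := by
      simp only [hA, he]; rw [← Real.exp_add]; congr 1; field_simp; ring
    have e2 : B * e (s - r/s) = Real.exp (-π * s^2 - π * r^2 / s^2) := by
      simp only [hB, he]; rw [← Real.exp_add]; congr 1; field_simp; ring
    rw [← mul_assoc, ← mul_assoc, e1, e2]; ring
  · refine ((hEtop.comp ?_).const_mul A).add ((hEbot.comp ?_).const_mul B)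
    · exact hid0.add_atTop hinv0
    · simpa [sub_eq_add_neg] using hid0.add_atBot (tendsto_neg_atTop_atBot.comp hinv0)
  · refine ((hEtop.comp ?_).const_mul A).add ((hEtop.comp ?_).const_mul B)
    · exact tendsto_id.atTop_add hinv1
    · simpa [sub_eq_add_neg] using tendsto_id.atTop_add hinv1.neg

theorem gauss_ft {n : ℕ} (s : ℝ) (hs : 0 < s) (x : EuclideanSpace ℝ (Fin n)) :
    (s:ℂ)^n * 𝓕 (fun v : EuclideanSpace ℝ (Fin n) => Complex.exp (-((π * s^2 : ℝ) : ℂ) * ‖v‖^2)) x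
      = ((Real.exp (-(π * ‖x‖^2 / s^2)) : ℝ) : ℂ) := by
  have hs' : (s:ℂ) ≠ 0 := by exact_mod_cast hs.ne'
  have hpi : (π:ℂ) ≠ 0 := by exact_mod_cast Real.pi_pos.ne'
  rw [fourier_gaussian_innerProductSpace (by rw [Complex.ofReal_re]; positivity)]
  have h1 : (π / ((π * s^2 : ℝ) : ℂ)) ^ ((Module.finrank ℝ (EuclideanSpace ℝ (Fin n)) : ℂ) / 2)
      = ((s:ℂ)^n)⁻¹ := by
    have h2 : (π / ((π * s^2 : ℝ) : ℂ)) = (((s⁻¹)^2 : ℝ) : ℂ) := by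
      push_cast; field_simp
    have h3 : ((Module.finrank ℝ (EuclideanSpace ℝ (Fin n)) : ℂ) / 2) = (((n:ℝ)/2 : ℝ) : ℂ) := by
      simp
    rw [h2, h3, ← Complex.ofReal_cpow (by positivity), ← Real.rpow_natCast (s⁻¹) 2,
      ← Real.rpow_mul (by positivity)]
    have : ((2:ℕ):ℝ) * ((n:ℝ)/2) = (n:ℝ) := by push_cast; ring
    rw [this, Real.rpow_natCast]
    push_cast
    rw [inv_pow]
  rw [h1, mul_inv_cancel_left₀ (pow_ne_zero _ hs')]
  push_cast
  congr 1
  field_simp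

noncomputable def poissonC (n : ℕ) : ℝ := π ^ (-((n:ℝ)+1)/2) * Real.Gamma (((n:ℝ)+1)/2)

noncomputable def poissonP {n : ℕ} (v : EuclideanSpace ℝ (Fin n)) : ℝ :=
  poissonC n * (1 + ‖v‖^2) ^ (-((n:ℝ)+1)/2)

theorem poissonC_pos (n : ℕ) : 0 < poissonC n := by
  have := Real.Gamma_pos_of_pos (s := ((n:ℝ)+1)/2) (by positivity)
  have := Real.pi_pos
  unfold poissonC; positivity

theorem poissonP_integrable {n : ℕ} :
    Integrable (poissonP : EuclideanSpace ℝ (Fin n) → ℝ) :=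
  (integrable_rpow_neg_one_add_norm_sq (by simp)).const_mul _

theorem poissonP_eq {n : ℕ} (v : EuclideanSpace ℝ (Fin n)) :
    ∫ s in Set.Ioi (0:ℝ), 2 * (s ^ n * Real.exp (-(π * (1+‖v‖^2)) * s^2)) = poissonP v := by
  have h := _root_.integral_rpow_mul_exp_neg_mul_rpow (p := 2) (q := n) (b := π * (1+‖v‖^2)) (by norm_num)
    (by have : (0:ℝ) ≤ n := by positivity
        linarith) (by have := Real.pi_pos; positivity)
  simp only [Real.rpow_natCast, Real.rpow_two] at h
  rw [integral_const_mul, h, Real.mul_rpow Real.pi_pos.le (by positivity)]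
  unfold poissonP poissonC
  ring

theorem poissonP_sint {n : ℕ} (v : EuclideanSpace ℝ (Fin n)) :
    IntegrableOn (fun s : ℝ => 2 * (s ^ n * Real.exp (-(π * (1+‖v‖^2)) * s^2))) (Set.Ioi 0) := by
  have h := integrableOn_rpow_mul_exp_neg_mul_sq (b := π * (1+‖v‖^2)) (s := n)
    (by have := Real.pi_pos; positivity) (by have : (0:ℝ) ≤ n := by positivity
                                             linarith)
  simp only [Real.rpow_natCast] at h
  exact Integrable.const_mul h _

theorem poisson_ft {n : ℕ} (x : EuclideanSpace ℝ (Fin n)) :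
    𝓕 (fun v : EuclideanSpace ℝ (Fin n) => ((poissonP v : ℝ) : ℂ)) x
      = ((Real.exp (-(2 * π * ‖x‖)) : ℝ) : ℂ) := by
  set H : EuclideanSpace ℝ (Fin n) → ℝ → ℂ := fun v s =>
    𝐞 (-inner ℝ v x) • ((2 * (s ^ n * Real.exp (-(π * (1+‖v‖^2)) * s^2)) : ℝ) : ℂ) with hH
  have hnorm : ∀ v, ∀ s ∈ Set.Ioi (0:ℝ),
      ‖H v s‖ = 2 * (s ^ n * Real.exp (-(π * (1+‖v‖^2)) * s^2)) := by
    intro v s hs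
    have hs : 0 < s := hs
    simp only [hH, Circle.norm_smul]
    rw [Complex.norm_real, Real.norm_of_nonneg (by positivity)]
  have hcont : Continuous (Function.uncurry H) := by
    simp only [hH, Function.uncurry_def, Circle.smul_def]
    fun_prop
  have hint : Integrable (Function.uncurry H) (volume.prod (volume.restrict (Set.Ioi (0:ℝ)))) := by
    rw [integrable_prod_iff hcont.aestronglyMeasurable]
    constructor
    · refine Eventually.of_forall fun v => ?_
      refine (poissonP_sint v).mono' (hcont.comp (by fun_prop : Continuous fun s : ℝ => (v, s))).aestronglyMeasurable ?_
      exact (ae_restrict_iff' measurableSet_Ioi).2 (Eventually.of_forall fun s hs => (hnorm v s hs).le)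
    · refine poissonP_integrable.congr (Eventually.of_forall fun v => ?_)
      rw [← poissonP_eq]
      exact (setIntegral_congr_fun measurableSet_Ioi fun s hs => hnorm v s hs).symm
  have hswap := integral_integral_swap hint
  have hL : 𝓕 (fun v : EuclideanSpace ℝ (Fin n) => ((poissonP v : ℝ) : ℂ)) x
      = ∫ v, ∫ s in Set.Ioi (0:ℝ), H v s := by
    rw [Real.fourier_eq]
    congr 1; ext v
    rw [← poissonP_eq, ← integral_complex_ofReal]
    simp only [hH, Circle.smul_def, smul_eq_mul]
    rw [integral_const_mul]
  have hR : ∀ s ∈ Set.Ioi (0:ℝ), ∫ v, H v s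
      = ((2 * Real.exp (-π * s^2 - π * ‖x‖^2 / s^2) : ℝ) : ℂ) := by
    intro s hs
    have h1 := gauss_ft s hs x
    have : -π * s^2 - π * ‖x‖^2 / s^2 = -π * s^2 + -(π * ‖x‖^2 / s^2) := by ring
    rw [this, Real.exp_add]
    push_cast [-Complex.ofReal_exp]
    rw [← h1, Real.fourier_eq, ← integral_const_mul, ← integral_const_mul, ← integral_const_mul]
    congr 1; ext v
    simp only [hH, Circle.smul_def, smul_eq_mul]
    have : -(π * (1+‖v‖^2)) * s^2 = -π * s^2 + -(π * s^2) * ‖v‖^2 := by ring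
    rw [this, Real.exp_add]
    push_cast
    ring
  rw [hL, hswap, setIntegral_congr_fun measurableSet_Ioi hR, integral_complex_ofReal,
    integral_const_mul, subord _ (norm_nonneg x)]
  congr 1; ring

/-- `h = k * f` with `f` Schwartz. -/
theorem conv_rep {n : ℕ} (h : SchwartzMap (EuclideanSpace ℝ (Fin n)) ℂ) :
    ∃ f : SchwartzMap (EuclideanSpace ℝ (Fin n)) ℂ, ∀ x,
      ∫ y, f y • ((Real.exp (-(2 * π * ‖x - y‖)) : ℝ) : ℂ) = h x := by
  let Q : EuclideanSpace ℝ (Fin n) → ℝ := fun v => (poissonC n)⁻¹ * (1 + ‖v‖^2) ^ (((n:ℝ)+1)/2)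
  have hQ : Function.HasTemperateGrowth Q := by
    have := Function.hasTemperateGrowth_one_add_norm_sq_rpow (EuclideanSpace ℝ (Fin n)) (((n:ℝ)+1)/2)
    fun_prop
  have hPQ : ∀ v, poissonP v * Q v = 1 := by
    intro v
    have h0 := (poissonC_pos n).ne'
    have : (0:ℝ) < 1 + ‖v‖^2 := by positivity
    have h1 : (1 + ‖v‖^2) ^ (-((n:ℝ)+1)/2) * (1 + ‖v‖^2) ^ (((n:ℝ)+1)/2) = 1 := by
      rw [← Real.rpow_add this, neg_div, neg_add_cancel, Real.rpow_zero]
    calc poissonP v * Q v = (poissonC n * (poissonC n)⁻¹) * ((1 + ‖v‖^2) ^ (-((n:ℝ)+1)/2) * (1 + ‖v‖^2) ^ (((n:ℝ)+1)/2)) := by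
          simp only [poissonP, Q]; ring
      _ = 1 := by rw [h1, mul_inv_cancel₀ h0, one_mul]
  let w : SchwartzMap (EuclideanSpace ℝ (Fin n)) ℂ := SchwartzMap.smulLeftCLM ℂ Q (𝓕 h)
  let f0 : SchwartzMap (EuclideanSpace ℝ (Fin n)) ℂ := 𝓕⁻ w
  refine ⟨f0, fun x => ?_⟩
  -- shifted kernel
  let Px : EuclideanSpace ℝ (Fin n) → ℂ := fun v => 𝐞 (inner ℝ v x) • ((poissonP v : ℝ) : ℂ)
  have hPx : Integrable Px := by
    have hP : Integrable (fun v : EuclideanSpace ℝ (Fin n) => ((poissonP v : ℝ) : ℂ)) :=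
      poissonP_integrable.ofReal
    refine hP.norm.mono' ?_ ?_
    · simp only [Px, Circle.smul_def, smul_eq_mul]
      refine AEStronglyMeasurable.mul ?_ hP.aestronglyMeasurable
      exact Continuous.aestronglyMeasurable (by fun_prop)
    · exact Eventually.of_forall fun v => by simp only [Px, Circle.norm_smul]; exact le_rfl
  have hk : ∀ y, ((Real.exp (-(2 * π * ‖x - y‖)) : ℝ) : ℂ) = 𝓕 Px y := by
    intro y
    rw [norm_sub_rev, ← poisson_ft (y - x), Real.fourier_eq, Real.fourier_eq]
    congr 1; ext v
    simp only [Px, smul_smul, ← AddChar.map_add_eq_mul]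
    congr 2
    rw [inner_sub_right]; ring
  have hself := VectorFourier.integral_fourierIntegral_smul_eq_flip (μ := volume) (ν := volume)
    (e := 𝐞) (L := innerₗ (EuclideanSpace ℝ (Fin n)))
    (f := ⇑f0) (g := Px) Real.continuous_fourierChar continuous_inner
    (SchwartzMap.integrable _) hPx
  simp_rw [hk]
  rw [flip_innerₗ] at hself
  refine hself.symm.trans ?_
  have h1 : VectorFourier.fourierIntegral 𝐞 volume (innerₗ (EuclideanSpace ℝ (Fin n))) (⇑f0) = ⇑w := by
    change 𝓕 (⇑f0) = ⇑w
    rw [← SchwartzMap.fourier_coe]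
    simp only [f0, FourierTransform.fourier_fourierInv_eq]
  rw [h1]
  have h2 : h x = 𝓕⁻ (⇑(𝓕 h : SchwartzMap (EuclideanSpace ℝ (Fin n)) ℂ)) x := by
    rw [← SchwartzMap.fourierInv_coe, FourierTransform.fourierInv_fourier_eq]
  rw [h2, Real.fourierInv_eq]
  congr 1; ext v
  simp only [Px, w, Circle.smul_def, smul_eq_mul, SchwartzMap.smulLeftCLM_apply_apply hQ]
  have := hPQ v
  have h3 : ((poissonP v : ℝ) : ℂ) * ((Q v : ℝ) : ℂ) = 1 := by exact_mod_cast this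
  rw [Complex.real_smul]
  linear_combination ((𝐞 (inner ℝ v x) : Circle) : ℂ) * (𝓕 h : SchwartzMap (EuclideanSpace ℝ (Fin n)) ℂ) v * h3

theorem exp_neg_lip {a b : ℝ} (ha : 0 ≤ a) (hb : 0 ≤ b) :
    |Real.exp (-a) - Real.exp (-b)| ≤ |a - b| := by
  have key : ∀ a b : ℝ, 0 ≤ a → a ≤ b → Real.exp (-a) - Real.exp (-b) ≤ b - a := by
    intro a b ha hab
    have h1 : Real.exp (-b) = Real.exp (-a) * Real.exp (-(b-a)) := by
      rw [← Real.exp_add]; congr 1; ring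
    have h2 := Real.add_one_le_exp (-(b-a))
    have h3 : Real.exp (-a) ≤ 1 := Real.exp_le_one_iff.2 (by linarith)
    have h4 := Real.exp_pos (-a)
    rw [h1]
    nlinarith
  rcases le_total a b with h | h
  · have h5 : Real.exp (-b) ≤ Real.exp (-a) := Real.exp_le_exp.2 (by linarith)
    rw [abs_of_nonneg (by linarith), abs_of_nonpos (by linarith)]
    linarith [key a b ha h]
  · have h5 : Real.exp (-a) ≤ Real.exp (-b) := Real.exp_le_exp.2 (by linarith)
    rw [abs_of_nonpos (by linarith), abs_of_nonneg (by linarith)]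
    linarith [key b a hb h]

noncomputable def lapK {n : ℕ} (y : EuclideanSpace ℝ (Fin n)) : EuclideanSpace ℝ (Fin n) →ᵇ ℂ :=
  BoundedContinuousFunction.ofNormedAddCommGroup
    (fun x => ((Real.exp (-(2 * π * ‖x - y‖)) : ℝ) : ℂ)) (by fun_prop) 1 (by
      intro x
      rw [Complex.norm_real, Real.norm_of_nonneg (Real.exp_pos _).le]
      have := Real.pi_pos
      exact Real.exp_le_one_iff.2 (by rw [neg_nonpos]; positivity))

theorem lapK_apply {n : ℕ} (y x : EuclideanSpace ℝ (Fin n)) :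
    lapK y x = ((Real.exp (-(2 * π * ‖x - y‖)) : ℝ) : ℂ) := rfl

theorem lapK_norm {n : ℕ} (y : EuclideanSpace ℝ (Fin n)) : ‖lapK y‖ ≤ 1 :=
  BoundedContinuousFunction.norm_ofNormedAddCommGroup_le _ zero_le_one _

theorem lapK_cont {n : ℕ} : Continuous (lapK : EuclideanSpace ℝ (Fin n) → _) := by
  have hp := Real.pi_pos
  refine (LipschitzWith.of_dist_le_mul (K := ⟨2 * π, by positivity⟩) fun y z => ?_).continuous
  have h0 : 0 ≤ 2 * π * dist y z := by positivity
  refine (BoundedContinuousFunction.dist_le h0).2 fun x => ?_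
  rw [lapK_apply, lapK_apply, dist_eq_norm, ← Complex.ofReal_sub, Complex.norm_real, Real.norm_eq_abs]
  refine (exp_neg_lip (by positivity) (by positivity)).trans ?_
  rw [← mul_sub, abs_mul, abs_of_pos (by positivity)]
  gcongr
  refine (abs_norm_sub_norm_le _ _).trans ?_
  rw [dist_eq_norm, norm_sub_rev y z]
  simp

theorem schwartz_mem {n : ℕ} (h : SchwartzMap (EuclideanSpace ℝ (Fin n)) ℂ) :
    ∃ F : EuclideanSpace ℝ (Fin n) →ᵇ ℂ, (∀ x, F x = h x) ∧
      F ∈ (Submodule.span ℂ (Set.range (lapK : EuclideanSpace ℝ (Fin n) → _))).topologicalClosure := by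
  obtain ⟨f, hf⟩ := conv_rep h
  set S := (Submodule.span ℂ (Set.range (lapK : EuclideanSpace ℝ (Fin n) → _))).topologicalClosure with hS
  have hc : IsClosed (S : Set (EuclideanSpace ℝ (Fin n) →ᵇ ℂ)) :=
    Submodule.isClosed_topologicalClosure _
  have : CompleteSpace S := hc.completeSpace_coe
  let G : EuclideanSpace ℝ (Fin n) → S := fun y =>
    ⟨f y • lapK y, S.smul_mem _ (Submodule.le_topologicalClosure _ (Submodule.subset_span ⟨y, rfl⟩))⟩
  have hGc : Continuous G := by
    refine Continuous.subtype_mk ?_ _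
    exact f.continuous.smul lapK_cont
  have hG : Integrable G := by
    refine (SchwartzMap.integrable (μ := volume) f).norm.mono' hGc.aestronglyMeasurable
      (Eventually.of_forall fun y => ?_)
    change ‖f y • lapK y‖ ≤ _
    rw [norm_smul]
    exact mul_le_of_le_one_right (norm_nonneg _) (lapK_norm y)
  refine ⟨S.subtypeL (∫ y, G y), fun x => ?_, (∫ y, G y).2⟩
  rw [← hf x]
  have := ContinuousLinearMap.integral_comp_comm
    ((BoundedContinuousFunction.evalCLM ℂ x).comp S.subtypeL) hG
  exact this.symm

theorem cc_approx {n : ℕ} 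
    (g : EuclideanSpace ℝ (Fin n) → ℂ) (hg : Continuous g)
    (hg0 : ∀ ε : ℝ, 0 < ε → IsCompact {x : EuclideanSpace ℝ (Fin n) | ε ≤ ‖g x‖})
    (ε : ℝ) (hε : 0 < ε) :
    ∃ h : SchwartzMap (EuclideanSpace ℝ (Fin n)) ℂ, ∀ x, ‖g x - h x‖ < 3 * ε := by
  let φ : EuclideanSpace ℝ (Fin n) → ℝ := fun x => max 0 (min 1 (‖g x‖ / ε - 1))
  have hφ : Continuous φ := by fun_prop
  let g' : EuclideanSpace ℝ (Fin n) → ℂ := fun x => (φ x : ℂ) * g x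
  have hg' : Continuous g' := by fun_prop
  obtain ⟨h, h1, h2, h3⟩ := hg'.exists_contDiff_approx ⊤ (ε := fun _ => ε) continuous_const (fun _ => hε)
  have hsupp : HasCompactSupport h := by
    refine HasCompactSupport.intro (hg0 ε hε) fun x hx => ?_
    by_contra hne
    apply h3 hne
    have hx : ‖g x‖ < ε := by simpa using hx
    have : ‖g x‖ / ε - 1 ≤ 0 := by rw [sub_nonpos, div_le_one hε]; exact hx.le
    have : φ x = 0 := max_eq_left ((min_le_right _ _).trans this)
    simp [g', this]
  refine ⟨hsupp.toSchwartzMap h1, fun x => ?_⟩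
  change ‖g x - h x‖ < 3 * ε
  have h4 : ‖g x - g' x‖ ≤ 2 * ε := by
    have e : g x - g' x = ((1 - φ x : ℝ) : ℂ) * g x := by simp only [g']; push_cast; ring
    have hφ0 : 0 ≤ φ x := le_max_left _ _
    have hφ1 : φ x ≤ 1 := max_le zero_le_one (min_le_left _ _)
    rw [e, norm_mul, Complex.norm_real, Real.norm_of_nonneg (by linarith)]
    rcases le_total ‖g x‖ (2*ε) with hx | hx
    · nlinarith [norm_nonneg (g x)]
    · have : 1 ≤ ‖g x‖ / ε - 1 := by
        have : 2 ≤ ‖g x‖ / ε := by rw [le_div_iff₀ hε]; exact hx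
        linarith
      have : φ x = 1 := by simp only [φ]; rw [min_eq_left this]; simp
      rw [this]; simp; positivity
  have h5 := h2 x
  rw [dist_eq_norm, norm_sub_rev] at h5
  calc ‖g x - h x‖ ≤ ‖g x - g' x‖ + ‖g' x - h x‖ := norm_sub_le_norm_sub_add_norm_sub _ _ _
    _ < 3 * ε := by linarith

theorem universal_aux {n : ℕ} 
    (g : EuclideanSpace ℝ (Fin n) → ℂ) (hg : Continuous g)
    (hg0 : ∀ ε : ℝ, 0 < ε → IsCompact {x : EuclideanSpace ℝ (Fin n) | ε ≤ ‖g x‖})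
    (ε : ℝ) (hε : 0 < ε) :
      ∃ (p : ℕ) (_ : 1 ≤ p) (x : Fin p → EuclideanSpace ℝ (Fin n)) (a : Fin p → ℂ),
        ∀ y : EuclideanSpace ℝ (Fin n),
          ‖g y - ∑ j : Fin p, a j * ((Real.exp (-(2 * π * ‖y - x j‖)) : ℝ) : ℂ)‖ < ε := by
  obtain ⟨h, hh⟩ := cc_approx g hg hg0 (ε / 6) (by positivity)
  obtain ⟨F, hF, hFS⟩ := schwartz_mem h
  obtain ⟨G, hG, hFG⟩ := Metric.mem_closure_iff.1 hFS (ε / 2) (by positivity)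
  obtain ⟨p, a, z, hz⟩ := Submodule.mem_span_set'.1 hG
  choose x hx using fun i => (z i).2
  refine ⟨p + 1, by omega, Fin.cons 0 x, Fin.cons 0 a, fun y => ?_⟩
  have e : ∑ j : Fin (p+1), (Fin.cons 0 a : Fin (p+1) → ℂ) j *
      ((Real.exp (-(2 * π * ‖y - (Fin.cons 0 x : Fin (p+1) → EuclideanSpace ℝ (Fin n)) j‖)) : ℝ) : ℂ) = G y := by
    rw [Fin.sum_univ_succ, ← hz]
    simp [← hx, lapK_apply]
  rw [e]
  have h1 := hh y
  have h2 := (BoundedContinuousFunction.dist_coe_le_dist (f := F) (g := G) y).trans_lt hFG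
  rw [dist_eq_norm, hF] at h2
  calc ‖g y - G y‖ ≤ ‖g y - h y‖ + ‖h y - G y‖ := norm_sub_le_norm_sub_add_norm_sub _ _ _
    _ < ε := by linarith

/-- For any length-scale `κ > 0`, the Laplacian kernel
`k(x,y) = exp(-‖x-y‖/κ)` on `ℝⁿ` is `C₀`-universal: every continuous `g : ℝⁿ → ℂ` vanishing at
infinity (all its superlevel sets are compact) can be approximated uniformly on `ℝⁿ`, to any
accuracy `ε > 0`, by finite linear combinations of translates of the Laplacian kernel. -/
theorem laplacian_kernel_C0_universal
    {n : ℕ} (κ : ℝ) (hκ : 0 < κ)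
    (g : EuclideanSpace ℝ (Fin n) → ℂ) (hg : Continuous g)
    (hg0 : ∀ ε : ℝ, 0 < ε → IsCompact {x : EuclideanSpace ℝ (Fin n) | ε ≤ ‖g x‖}) :
    ∀ ε : ℝ, 0 < ε →
      ∃ (p : ℕ) (_ : 1 ≤ p) (x : Fin p → EuclideanSpace ℝ (Fin n)) (a : Fin p → ℂ),
        ∀ y : EuclideanSpace ℝ (Fin n),
          ‖g y - ∑ j : Fin p, a j * Complex.exp (-((‖y - x j‖ / κ : ℝ) : ℂ))‖ < ε := by
  intro ε hε
  have hp := Real.pi_pos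
  set c : ℝ := 2 * π * κ with hc
  have hc0 : 0 < c := by positivity
  obtain ⟨p, hp1, x, a, h⟩ := universal_aux (fun y => g (c • y)) (by fun_prop) (fun δ hδ => by
    have := (Homeomorph.smulOfNeZero (α := EuclideanSpace ℝ (Fin n)) c hc0.ne').isClosedEmbedding.isCompact_preimage (hg0 δ hδ)
    exact this) ε hε
  refine ⟨p, hp1, fun j => c • x j, a, fun y => ?_⟩
  have hy := h (c⁻¹ • y)
  simp only [smul_inv_smul₀ hc0.ne'] at hy
  convert hy using 5 with j
  rw [← Complex.ofReal_neg, ← Complex.ofReal_exp]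
  congr 3
  have : y - c • x j = c • (c⁻¹ • y - x j) := by rw [smul_sub, smul_inv_smul₀ hc0.ne']
  rw [this, norm_smul, Real.norm_of_nonneg hc0.le, hc]
  field_simp
end

section
/- Let n ≥ 1 and let α be a real number with α > (n−1)/2. Then the real Beta-prime kernel is positive semidefinite on the cone of real symmetric positive-definite n×n matrices: for every p ≥ 1, all real symmetric positive-definite n×n matrices x₁, …, x_p and all coefficients c₁, …, c_p ∈ ℂ, the sum ∑_{i,j=1}^p c_i · conj(c_j) · ((det x_i · det x_j)/(det(x_i + x_j))²)^α is a nonnegative real number. Here each x_i + x_j is positive-definite, so det(x_i + x_j) > 0 and the real power is well-defined. -/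
open Complex Finset
open scoped ComplexOrder

namespace BetaPrimeAux

open MeasureTheory Matrix

/-- An integral of positive semidefinite kernels is positive semidefinite. -/
lemma posSemidef_integral {X : Type*} [MeasurableSpace X] {μ : Measure X} {p : ℕ}
    (k : X → Matrix (Fin p) (Fin p) ℝ) (hk : ∀ t, (k t).PosSemidef)
    (hint : ∀ i j, Integrable (fun t => k t i j) μ) :
    (Matrix.of fun i j => ∫ t, k t i j ∂μ).PosSemidef := by
  refine Matrix.PosSemidef.of_dotProduct_mulVec_nonneg ?_ ?_
  · ext i j
    simp only [conjTranspose_apply, of_apply, star_trivial]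
    congr 1
    ext t
    simpa using (hk t).isHermitian.apply i j
  · intro v
    have h : star v ⬝ᵥ ((Matrix.of fun i j => ∫ t, k t i j ∂μ) *ᵥ v)
        = ∫ t, star v ⬝ᵥ (k t *ᵥ v) ∂μ := by
      simp only [dotProduct, mulVec, of_apply]
      rw [integral_finsetSum]
      · refine Finset.sum_congr rfl fun i _ => ?_
        rw [integral_const_mul, integral_finsetSum]
        · simp_rw [integral_mul_const]
        · exact fun j _ => (hint i j).mul_const _
      · exact fun i _ => (integrable_finsetSum _ fun j _ => (hint i j).mul_const _).const_mul _
    rw [h]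
    exact integral_nonneg fun t => (hk t).dotProduct_mulVec_nonneg v

lemma posSemidef_rankOne {p : ℕ} (f : Fin p → ℝ) :
    (Matrix.of fun i j => f i * f j).PosSemidef := by
  have := posSemidef_vecMulVec_self_star (R := ℝ) f
  refine (congrArg Matrix.PosSemidef ?_).mpr this
  ext i j
  simp [vecMulVec_apply]

lemma integral_gauss_std (n : ℕ) :
    ∫ v : Fin n → ℝ, Real.exp (-(v ⬝ᵥ v)) = √Real.pi ^ n := by
  have h := integral_fintype_prod_volume_eq_pow (ι := Fin n) (fun x : ℝ => Real.exp (-1 * x ^ 2))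
  rw [integral_gaussian, Fintype.card_fin, div_one] at h
  rw [← h]
  congr 1
  ext v
  rw [← Real.exp_sum, dotProduct, ← Finset.sum_neg_distrib]
  congr 1
  refine Finset.sum_congr rfl fun i _ => ?_
  ring

lemma integral_gauss {n : ℕ} (D : Matrix (Fin n) (Fin n) ℝ) (hD : D.PosDef) :
    ∫ v : Fin n → ℝ, Real.exp (-(v ⬝ᵥ (D *ᵥ v))) = √Real.pi ^ n * D.det ^ (-(1 / 2) : ℝ) := by
  obtain ⟨B, hB⟩ : ∃ B : Matrix (Fin n) (Fin n) ℝ, D = Bᵀ * B := by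
    open scoped MatrixOrder in
    obtain ⟨y, hy⟩ := CStarAlgebra.nonneg_iff_eq_star_mul_self.mp hD.posSemidef.nonneg
    exact ⟨y, by simpa [star_eq_conjTranspose] using hy⟩
  have hdet : D.det = B.det ^ 2 := by rw [hB, det_mul, det_transpose, sq]
  have hpos := hD.det_pos
  have hB0 : B.det ≠ 0 := by
    intro h
    rw [hdet, h] at hpos
    simp at hpos
  have h1 := Real.map_matrix_volume_pi_eq_smul_volume_pi hB0
  have h2 : ∫ v : Fin n → ℝ, Real.exp (-(v ⬝ᵥ v)) ∂(Measure.map (toLin' B) volume)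
      = ∫ v : Fin n → ℝ, Real.exp (-(v ⬝ᵥ (D *ᵥ v))) := by
    rw [integral_map]
    · congr 1
      ext v
      rw [toLin'_apply, hB, ← mulVec_mulVec, dotProduct_mulVec v, vecMul_transpose]
    · exact (LinearMap.continuous_on_pi _).aemeasurable
    · refine Continuous.aestronglyMeasurable ?_
      unfold dotProduct
      fun_prop
  rw [← h2, h1, integral_smul_measure, integral_gauss_std, ENNReal.toReal_ofReal (abs_nonneg _),
    smul_eq_mul, mul_comm]
  congr 1
  rw [Real.rpow_neg hpos.le, ← Real.sqrt_eq_rpow, hdet, Real.sqrt_sq_eq_abs, abs_inv]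

lemma integral_gauss_shift {n : ℕ} (D : Matrix (Fin n) (Fin n) ℝ) (hD : D.PosDef)
    (b : Fin n → ℝ) (t : ℝ) :
    ∫ v : Fin n → ℝ, Real.exp (-(v ⬝ᵥ (D *ᵥ v)) - 2 * t * (b ⬝ᵥ v))
      = √Real.pi ^ n * D.det ^ (-(1 / 2) : ℝ) * Real.exp (t ^ 2 * (b ⬝ᵥ (D⁻¹ *ᵥ b))) := by
  have hu : IsUnit D.det := hD.det_pos.ne'.isUnit
  have hsym : Dᵀ = D := by simpa using hD.isHermitian.eq
  set w := D⁻¹ *ᵥ b with hw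
  have hDw : D *ᵥ w = b := by rw [hw, mulVec_mulVec, mul_nonsing_inv _ hu, one_mulVec]
  have hsw : ∀ v : Fin n → ℝ, w ⬝ᵥ (D *ᵥ v) = b ⬝ᵥ v := by
    intro v
    rw [dotProduct_mulVec, ← mulVec_transpose, hsym, hDw]
  rw [← integral_gauss D hD, ← integral_add_right_eq_self _ ((-t) • w), ← integral_mul_const]
  congr 1
  ext v
  rw [← Real.exp_add]
  congr 1
  simp only [mulVec_add, mulVec_smul, dotProduct_add, add_dotProduct, smul_dotProduct,
    dotProduct_smul, hDw, hsw, smul_eq_mul]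
  rw [dotProduct_comm v b, dotProduct_comm w b]
  ring

/-- Top-left block. -/
def blk {n : ℕ} (x : Matrix (Fin (n + 1)) (Fin (n + 1)) ℝ) : Matrix (Fin n) (Fin n) ℝ :=
  x.submatrix Fin.castSucc Fin.castSucc

/-- Last column without its last entry. -/
def col {n : ℕ} (x : Matrix (Fin (n + 1)) (Fin (n + 1)) ℝ) : Fin n → ℝ :=
  fun i => x i.castSucc (Fin.last n)

lemma blk_add {n : ℕ} (x y : Matrix (Fin (n + 1)) (Fin (n + 1)) ℝ) :
    blk (x + y) = blk x + blk y := rfl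

lemma col_add {n : ℕ} (x y : Matrix (Fin (n + 1)) (Fin (n + 1)) ℝ) :
    col (x + y) = col x + col y := rfl

lemma blk_posDef {n : ℕ} {x : Matrix (Fin (n + 1)) (Fin (n + 1)) ℝ} (hx : x.PosDef) :
    (blk x).PosDef := hx.submatrix (Fin.castSucc_injective n)

lemma det_eq {n : ℕ} {x : Matrix (Fin (n + 1)) (Fin (n + 1)) ℝ} (hx : x.PosDef) :
    x.det = (blk x).det *
      (x (Fin.last n) (Fin.last n) - col x ⬝ᵥ ((blk x)⁻¹ *ᵥ col x)) := by
  have hsym : ∀ i j, x i j = x j i := fun i j => by simpa using hx.isHermitian.apply j i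
  have hu : IsUnit (blk x).det := (blk_posDef hx).det_pos.ne'.isUnit
  let _ : Invertible (blk x) := invertibleOfIsUnitDet _ hu
  have hb : x.submatrix finSumFinEquiv finSumFinEquiv
      = fromBlocks (blk x) (Matrix.of fun i (_ : Fin 1) => col x i)
        (Matrix.of fun (_ : Fin 1) i => col x i)
        (Matrix.of fun _ _ => x (Fin.last n) (Fin.last n)) := by
    ext i j
    rcases i with i | i <;> rcases j with j | j
    · rfl
    · obtain rfl : j = 0 := Subsingleton.elim _ _
      rfl
    · obtain rfl : i = 0 := Subsingleton.elim _ _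
      exact hsym _ _
    · obtain rfl : i = 0 := Subsingleton.elim _ _
      obtain rfl : j = 0 := Subsingleton.elim _ _
      rfl
  rw [← det_submatrix_equiv_self (finSumFinEquiv : Fin n ⊕ Fin 1 ≃ Fin (n + 1)) x, hb,
    det_fromBlocks₁₁]
  congr 1
  rw [det_fin_one, Matrix.sub_apply, Matrix.mul_assoc, invOf_eq_nonsing_inv]
  rfl

/-- Schur complement of the top-left block. -/
noncomputable def schur {n : ℕ} (x : Matrix (Fin (n + 1)) (Fin (n + 1)) ℝ) : ℝ :=
  x (Fin.last n) (Fin.last n) - col x ⬝ᵥ ((blk x)⁻¹ *ᵥ col x)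

lemma schur_pos {n : ℕ} {x : Matrix (Fin (n + 1)) (Fin (n + 1)) ℝ} (hx : x.PosDef) :
    0 < schur x := by
  have h := det_eq hx
  have h1 := hx.det_pos
  rw [h] at h1
  exact (pos_iff_pos_of_mul_pos h1).1 (blk_posDef hx).det_pos

lemma step_exp {n p : ℕ} (x : Fin p → Matrix (Fin (n + 1)) (Fin (n + 1)) ℝ)
    (hx : ∀ i, (x i).PosDef) (t : ℝ) :
    (Matrix.of fun i j => √Real.pi ^ n * (blk (x i + x j)).det ^ (-(1 / 2) : ℝ) *
      Real.exp (-(t ^ 2 * schur (x i + x j)))).PosSemidef := by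
  set F : Fin p → (Fin n → ℝ) → ℝ := fun i v => Real.exp
    (-(v ⬝ᵥ (blk (x i) *ᵥ v)) - 2 * t * (col (x i) ⬝ᵥ v)
      - t ^ 2 * x i (Fin.last n) (Fin.last n)) with hF
  have hval : ∀ i j, ∫ v, F i v * F j v = √Real.pi ^ n *
      (blk (x i + x j)).det ^ (-(1 / 2) : ℝ) * Real.exp (-(t ^ 2 * schur (x i + x j))) := by
    intro i j
    have hs := (hx i).add (hx j)
    have h := integral_gauss_shift _ (blk_posDef hs) (col (x i + x j)) t
    have e : -(t ^ 2 * schur (x i + x j)) = t ^ 2 * (col (x i + x j) ⬝ᵥ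
        ((blk (x i + x j))⁻¹ *ᵥ col (x i + x j)))
        + -(t ^ 2 * (x i + x j) (Fin.last n) (Fin.last n)) := by
      unfold schur
      ring
    rw [e, Real.exp_add, ← mul_assoc, ← h, ← integral_mul_const]
    congr 1
    ext v
    rw [hF]
    simp only
    rw [← Real.exp_add, ← Real.exp_add, blk_add, col_add, add_mulVec, dotProduct_add,
      add_dotProduct, Matrix.add_apply]
    congr 1
    ring
  have := posSemidef_integral (μ := (volume : Measure (Fin n → ℝ)))
    (fun v => Matrix.of fun i j => F i v * F j v) (fun v => posSemidef_rankOne _) ?_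
  · simp only [of_apply, hval] at this
    exact this
  · intro i j
    simp only [of_apply]
    refine Integrable.of_integral_ne_zero ?_
    rw [hval]
    have := (blk_posDef ((hx i).add (hx j))).det_pos
    have := Real.pi_pos
    positivity

lemma step_gamma {n p : ℕ} (x : Fin p → Matrix (Fin (n + 1)) (Fin (n + 1)) ℝ)
    (hx : ∀ i, (x i).PosDef) (s : ℝ) (hs : 0 < s) :
    (Matrix.of fun i j => (blk (x i + x j)).det ^ (-(1 / 2) : ℝ) *
      schur (x i + x j) ^ (-s)).PosSemidef := by
  have hval : ∀ i j, ∫ t in Set.Ioi (0 : ℝ), (|t| ^ (s - 1)) * (√Real.pi ^ n *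
      (blk (x i + x j)).det ^ (-(1 / 2) : ℝ) * Real.exp (-(√t ^ 2 * schur (x i + x j))))
      = (√Real.pi ^ n * Real.Gamma s) * ((blk (x i + x j)).det ^ (-(1 / 2) : ℝ) *
        schur (x i + x j) ^ (-s)) := by
    intro i j
    have hp := schur_pos ((hx i).add (hx j))
    have h := Real.integral_rpow_mul_exp_neg_mul_Ioi hs hp
    rw [one_div, Real.inv_rpow hp.le, ← Real.rpow_neg hp.le] at h
    have e : (√Real.pi ^ n * Real.Gamma s) * ((blk (x i + x j)).det ^ (-(1 / 2) : ℝ) *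
        schur (x i + x j) ^ (-s)) = (√Real.pi ^ n * (blk (x i + x j)).det ^ (-(1 / 2) : ℝ)) *
        (schur (x i + x j) ^ (-s) * Real.Gamma s) := by ring
    rw [e, ← h, ← integral_const_mul]
    refine setIntegral_congr_fun measurableSet_Ioi fun t ht => ?_
    have ht' : (0 : ℝ) < t := ht
    rw [abs_of_pos ht', Real.sq_sqrt ht'.le, mul_comm t]
    ring
  have hc : 0 < √Real.pi ^ n * Real.Gamma s := by
    have := Real.pi_pos
    have := Real.Gamma_pos_of_pos hs
    positivity
  have := posSemidef_integral (μ := volume.restrict (Set.Ioi (0 : ℝ)))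
    (fun t => (|t| ^ (s - 1)) • (Matrix.of fun i j => √Real.pi ^ n *
      (blk (x i + x j)).det ^ (-(1 / 2) : ℝ) * Real.exp (-(√t ^ 2 * schur (x i + x j)))))
    (fun t => (step_exp x hx _).smul (by positivity)) ?_
  · simp only [Matrix.smul_apply, of_apply, smul_eq_mul, hval] at this
    have h2 := this.smul (inv_pos.2 hc).le
    refine (congrArg Matrix.PosSemidef ?_).mpr h2
    ext i j
    simp only [Matrix.smul_apply, of_apply, smul_eq_mul]
    rw [inv_mul_cancel_left₀ hc.ne']
  · intro i j
    simp only [Matrix.smul_apply, of_apply, smul_eq_mul]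
    refine Integrable.of_integral_ne_zero ?_
    rw [hval]
    have := (blk_posDef ((hx i).add (hx j))).det_pos
    have := schur_pos ((hx i).add (hx j))
    positivity

theorem det_kernel (n : ℕ) : ∀ s : ℝ, ((n : ℝ) - 1) / 2 < s → ∀ (p : ℕ)
    (x : Fin p → Matrix (Fin n) (Fin n) ℝ), (∀ i, (x i).PosDef) →
    (Matrix.of fun i j => (x i + x j).det ^ (-s)).PosSemidef := by
  induction n with
  | zero =>
    intro s _ p x _
    have := posSemidef_rankOne (fun _ : Fin p => (1 : ℝ))
    simpa using this
  | succ n ih =>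
    intro s hs p x hx
    push_cast at hs
    have hn : (0 : ℝ) ≤ n := Nat.cast_nonneg n
    have h1 := step_gamma x hx s (by linarith)
    have h2 := ih (s - 1 / 2) (by linarith) p (fun i => blk (x i)) fun i => blk_posDef (hx i)
    have h3 := h1.hadamard h2
    refine (congrArg Matrix.PosSemidef ?_).mpr h3
    ext i j
    have hp := (hx i).add (hx j)
    have hb := (blk_posDef hp).det_pos
    have hS := schur_pos hp
    simp only [of_apply, hadamard_apply, ← blk_add]
    rw [det_eq hp]
    change ((blk (x i + x j)).det * schur (x i + x j)) ^ (-s) = _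
    rw [Real.mul_rpow hb.le hS.le, mul_right_comm, ← Real.rpow_add hb]
    congr 2
    ring

lemma complex_nonneg {p : ℕ} {M : Matrix (Fin p) (Fin p) ℝ} (hM : M.PosSemidef) (c : Fin p → ℂ) :
    0 ≤ ∑ i, ∑ j, c i * (starRingEnd ℂ) (c j) * ((M i j : ℝ) : ℂ) := by
  obtain ⟨B, hB⟩ : ∃ B : Matrix (Fin p) (Fin p) ℝ, M = Bᵀ * B := by
    open scoped MatrixOrder in
    obtain ⟨y, hy⟩ := CStarAlgebra.nonneg_iff_eq_star_mul_self.mp hM.nonneg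
    exact ⟨y, by simpa [star_eq_conjTranspose] using hy⟩
  have : ∑ i, ∑ j, c i * (starRingEnd ℂ) (c j) * ((M i j : ℝ) : ℂ)
      = ∑ k, (∑ i, c i * (B k i : ℂ)) * (starRingEnd ℂ) (∑ i, c i * (B k i : ℂ)) := by
    simp only [map_sum, map_mul, Complex.conj_ofReal, Finset.sum_mul_sum]
    rw [Finset.sum_comm]
    conv_rhs => rw [Finset.sum_comm]
    rw [Finset.sum_comm]
    refine Finset.sum_congr rfl fun i _ => ?_
    rw [Finset.sum_comm]
    refine Finset.sum_congr rfl fun j _ => ?_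
    rw [hB, mul_apply]
    push_cast
    rw [Finset.mul_sum]
    refine Finset.sum_congr rfl fun k _ => ?_
    rw [transpose_apply]
    ring
  rw [this]
  refine Finset.sum_nonneg fun k _ => ?_
  rw [Complex.mul_conj]
  exact_mod_cast Complex.normSq_nonneg _

end BetaPrimeAux

/-- For `n ≥ 1` and real `α > (n-1)/2`, the real Beta-prime kernel
`k_α(x,y) = (det x · det y / det(x+y)²)^α` is positive semidefinite on the cone of real
symmetric positive-definite `n×n` matrices (the order on `ℂ` being the one in which
`0 ≤ z` iff `z` is a nonnegative real number). -/
theorem betaPrime_kernel_posSemidef_real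
    (n : ℕ) (hn : 1 ≤ n) (α : ℝ) (hα : ((n : ℝ) - 1) / 2 < α) :
    ∀ (p : ℕ), 1 ≤ p → ∀ (x : Fin p → Matrix (Fin n) (Fin n) ℝ),
      (∀ i, (x i).PosDef) → ∀ c : Fin p → ℂ,
        0 ≤ ∑ i : Fin p, ∑ j : Fin p, c i * (starRingEnd ℂ) (c j) *
          (((((x i).det * (x j).det) / ((x i + x j).det) ^ 2) ^ α : ℝ) : ℂ) := by
  intro p _ x hx c
  have hn' : (1 : ℝ) ≤ n := by exact_mod_cast hn
  have hM := BetaPrimeAux.det_kernel n (2 * α) (by linarith) p x hx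
  have h := BetaPrimeAux.complex_nonneg hM (fun i => c i * (((x i).det ^ α : ℝ) : ℂ))
  refine h.trans_eq (Finset.sum_congr rfl fun i _ => Finset.sum_congr rfl fun j _ => ?_)
  have hi := (hx i).det_pos
  have hj := (hx j).det_pos
  have hij := ((hx i).add (hx j)).det_pos
  have e : ((x i).det * (x j).det / (x i + x j).det ^ 2) ^ α
      = (x i).det ^ α * (x j).det ^ α * (x i + x j).det ^ (-(2 * α)) := by
    rw [Real.div_rpow (by positivity) (by positivity), Real.mul_rpow hi.le hj.le,
      Real.rpow_neg hij.le, Real.rpow_mul hij.le, div_eq_mul_inv]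
    norm_cast
  rw [e, Matrix.of_apply, map_mul, Complex.conj_ofReal]
  push_cast
  ring
end

section
/- Let n ≥ 1 and let α be a real number with α > n−1. Then the complex Beta-prime kernel is positive semidefinite on the cone of complex Hermitian positive-definite n×n matrices: for every p ≥ 1, all complex Hermitian positive-definite n×n matrices x₁, …, x_p (whose determinants, and the determinants det(x_i + x_j), are positive real numbers) and all coefficients c₁, …, c_p ∈ ℂ, the sum ∑_{i,j=1}^p c_i · conj(c_j) · ((det x_i · det x_j)/(det(x_i + x_j))²)^α is a nonnegative real number. -/
open Complex Finset
open scoped ComplexOrder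
section BetaPrimeAux
open Matrix MeasureTheory

lemma bp_det {m : Type*} [Fintype m] [DecidableEq m] {x : Matrix m m ℂ} (hx : x.PosDef) :
    ((x.det.re : ℝ) : ℂ) = x.det ∧ 0 < x.det.re := by
  have h := hx.det_pos
  rw [Complex.lt_def] at h
  refine ⟨?_, by simpa using h.1⟩
  apply Complex.ext <;> simp [← h.2]

lemma bp_factor {m : Type*} [Fintype m] [DecidableEq m] {x : Matrix (Unit ⊕ m) (Unit ⊕ m) ℂ}
    (hx : x.PosDef) : ∃ (R : Matrix (Unit ⊕ m) (Unit ⊕ m) ℂ) (σ : ℝ), x = Rᴴ * R ∧ 0 < σ ∧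
      (∀ v : Unit ⊕ m → ℂ, (R *ᵥ v) (Sum.inl ()) = σ * v (Sum.inl ())) ∧
      σ ^ 2 * (x.submatrix Sum.inr Sum.inr).det.re = x.det.re := by
  have hD : (x.submatrix Sum.inr Sum.inr).PosDef := hx.submatrix Sum.inr_injective
  obtain ⟨h1, h2⟩ := bp_det hx
  obtain ⟨h3, h4⟩ := bp_det hD
  obtain ⟨N, hN⟩ : ∃ N, x.submatrix Sum.inr Sum.inr = star N * N := by
    open scoped MatrixOrder in
    exact CStarAlgebra.nonneg_iff_eq_star_mul_self.1 hD.posSemidef.nonneg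
  rw [star_eq_conjTranspose] at hN
  have hNu : IsUnit N.det := by
    rw [isUnit_iff_ne_zero]
    intro h0
    rw [hN, det_mul, h0] at h4
    simp at h4
  set D := x.submatrix Sum.inr Sum.inr with hDdef
  set B : Matrix m Unit ℂ := x.submatrix Sum.inr Sum.inl with hB
  set A : Matrix Unit Unit ℂ := x.submatrix Sum.inl Sum.inl with hA
  have hBx : Bᴴ = x.submatrix Sum.inl Sum.inr := by
    rw [hB, conjTranspose_submatrix, hx.1.eq]
  have hxb : x = fromBlocks A Bᴴ B D := by
    rw [hBx]; ext (i|i) (j|j) <;> rfl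
  have hDu : IsUnit D := hD.isUnit
  let _ := hDu.invertible
  set S := A - Bᴴ * D⁻¹ * B with hS
  have hdet : x.det = D.det * S.det := by
    conv_lhs => rw [hxb]
    rw [det_fromBlocks₂₂, invOf_eq_nonsing_inv]
  set σ := Real.sqrt (x.det.re / D.det.re) with hσ
  have hpos : 0 < x.det.re / D.det.re := div_pos h2 h4
  have hσ2 : σ ^ 2 = x.det.re / D.det.re := Real.sq_sqrt hpos.le
  have hSσ : S () () = (σ : ℂ) ^ 2 := by
    have : S.det = S () () := by simp
    rw [← this, ← Complex.ofReal_pow, hσ2, Complex.ofReal_div, h1, h3, hdet]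
    rw [mul_div_cancel_left₀]
    rw [← h3]; exact_mod_cast h4.ne'
  have hDi : D⁻¹ = N⁻¹ * (Nᴴ)⁻¹ := by rw [hN, Matrix.mul_inv_rev]
  have hNhu : IsUnit (Nᴴ).det := by rw [det_conjTranspose]; exact hNu.star
  refine ⟨fromBlocks (diagonal fun _ => (σ : ℂ)) 0 ((Nᴴ)⁻¹ * B) N, σ, ?_, Real.sqrt_pos.2 hpos, ?_, ?_⟩
  · conv_lhs => rw [hxb]
    rw [fromBlocks_conjTranspose, fromBlocks_multiply]
    congr 1
    · have : A = S + Bᴴ * D⁻¹ * B := by rw [hS]; abel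
      rw [this, hDi, conjTranspose_mul, conjTranspose_nonsing_inv, conjTranspose_conjTranspose]
      congr 1
      · ext i j
        simp [hSσ, pow_two]
      · simp only [Matrix.mul_assoc]
    · rw [conjTranspose_mul, conjTranspose_nonsing_inv, conjTranspose_conjTranspose, Matrix.mul_assoc, nonsing_inv_mul _ hNu]
      simp
    · rw [← Matrix.mul_assoc, mul_nonsing_inv _ hNhu]; simp
    · rw [hN]; simp
  · intro v
    simp [mulVec, dotProduct]
  · rw [hσ2]; field_simp

lemma bp_base {m : Type*} [Fintype m] [DecidableEq m] {q : ℝ} (hq : -2 < q) :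
    0 < ∫ v : (Unit ⊕ m → ℂ), ‖v (Sum.inl ())‖ ^ q * Real.exp (-∑ i, ‖v i‖ ^ 2) := by
  have h : ∀ v : Unit ⊕ m → ℂ, ‖v (Sum.inl ())‖ ^ q * Real.exp (-∑ i, ‖v i‖ ^ 2) =
    ∏ i, (fun (i : Unit ⊕ m) (z : ℂ) => ‖z‖ ^ (Sum.elim (fun _ => q) (fun _ => 0) i : ℝ) * Real.exp (-‖z‖ ^ (2:ℝ))) i (v i) := by
    intro v
    simp only [Finset.prod_mul_distrib, ← Real.exp_sum]
    simp [Fintype.prod_sum_type]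
  rw [integral_congr_ae (ae_of_all _ h), integral_fintype_prod_volume_eq_prod
    (fun (i : Unit ⊕ m) (z : ℂ) => ‖z‖ ^ (Sum.elim (fun _ => q) (fun _ => 0) i : ℝ) *
      Real.exp (-‖z‖ ^ (2:ℝ)))]
  apply Finset.prod_pos
  rintro (i|i) -
  · simp only [Sum.elim_inl]
    rw [Complex.integral_rpow_mul_exp_neg_rpow (by norm_num) hq]
    have := Real.Gamma_pos_of_pos (s := (q+2)/2) (by linarith)
    positivity
  · simp only [Sum.elim_inr]
    rw [Complex.integral_rpow_mul_exp_neg_rpow (by norm_num) (by norm_num)]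
    have := Real.Gamma_pos_of_pos (s := (0+2)/2) (by norm_num)
    positivity

lemma bp_change {m : Type*} [Fintype m] [DecidableEq m] (R : Matrix m m ℂ) (hR : R.det ≠ 0)
    (g : (m → ℂ) → ℝ) : ∫ v, g (R *ᵥ v) = (Complex.normSq R.det)⁻¹ * ∫ v, g v := by
  set f : (m → ℂ) →ₗ[ℝ] (m → ℂ) := (Matrix.toLin' R).restrictScalars ℝ with hf
  have hd : LinearMap.det f = Complex.normSq R.det := by
    rw [hf, LinearMap.det_restrictScalars, Algebra.norm_complex_apply, LinearMap.det_toLin']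
  have hd0 : LinearMap.det f ≠ 0 := by rw [hd]; simpa using hR
  have key := Measure.map_linearMap_addHaar_eq_smul_addHaar (volume : Measure (m → ℂ)) hd0
  let e : (m → ℂ) ≃L[ℝ] (m → ℂ) := (LinearEquiv.ofIsUnitDet (f := f) (v := Module.finBasis ℝ _) (v' := Module.finBasis ℝ _)
    (by rw [LinearMap.det_toMatrix]; exact isUnit_iff_ne_zero.2 hd0)).toContinuousLinearEquiv
  have he : ∀ v, e v = R *ᵥ v := fun v => rfl
  have h1 : ∫ v, g (R *ᵥ v) = ∫ v, g v ∂(Measure.map f volume) := by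
    rw [show (f : (m → ℂ) → (m → ℂ)) = e.toHomeomorph.toMeasurableEquiv from rfl, integral_map_equiv]
    rfl
  rw [h1, key, integral_smul_measure, hd, ENNReal.toReal_ofReal (abs_nonneg _), abs_of_nonneg (by positivity [Complex.normSq_nonneg R.det]), smul_eq_mul]

lemma bp_key {m : Type*} [Fintype m] [DecidableEq m] {s : ℝ} (hs : 0 < s) :
    ∃ C : ℝ, 0 < C ∧ ∀ x : Matrix (Unit ⊕ m) (Unit ⊕ m) ℂ, x.PosDef →
      ∫ v : (Unit ⊕ m → ℂ), ‖v (Sum.inl ())‖ ^ (2 * (s - 1)) * Real.exp (-(star v ⬝ᵥ x *ᵥ v).re) =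
      C * (x.det.re ^ (-s) * (x.submatrix Sum.inr Sum.inr).det.re ^ (s - 1)) := by
  refine ⟨_, bp_base (m := m) (q := 2 * (s - 1)) (by linarith), ?_⟩
  intro x hx
  obtain ⟨R, σ, hxR, hσ, hRv, hdet⟩ := bp_factor hx
  obtain ⟨h1, h2⟩ := bp_det hx
  obtain ⟨h3, h4⟩ := bp_det (hx.submatrix (e := Sum.inr) Sum.inr_injective)
  have hRdet : Complex.normSq R.det = x.det.re := by
    have : ((Complex.normSq R.det : ℝ) : ℂ) = x.det := by
      rw [hxR, det_mul, det_conjTranspose, Complex.normSq_eq_conj_mul_self]; rfl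
    rw [← this, Complex.ofReal_re]
  have hR0 : R.det ≠ 0 := by
    rw [← Complex.normSq_pos, hRdet]; exact h2
  have hg : ∀ v : Unit ⊕ m → ℂ,
      ‖v (Sum.inl ())‖ ^ (2 * (s - 1)) * Real.exp (-(star v ⬝ᵥ x *ᵥ v).re) =
      (σ ^ (2 * (s - 1)))⁻¹ * (fun u : Unit ⊕ m → ℂ =>
        ‖u (Sum.inl ())‖ ^ (2 * (s - 1)) * Real.exp (-∑ i, ‖u i‖ ^ 2)) (R *ᵥ v) := by
    intro v
    have e1 : (star v ⬝ᵥ x *ᵥ v).re = ∑ i, ‖(R *ᵥ v) i‖ ^ 2 := by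
      have : star v ⬝ᵥ x *ᵥ v = star (R *ᵥ v) ⬝ᵥ (R *ᵥ v) := by
        rw [hxR, ← mulVec_mulVec, dotProduct_mulVec, star_mulVec]
      rw [this]
      simp only [dotProduct, Complex.re_sum]
      refine Finset.sum_congr rfl fun i _ => ?_
      rw [Pi.star_apply, Complex.star_def, ← Complex.normSq_eq_conj_mul_self, Complex.ofReal_re,
        Complex.normSq_eq_norm_sq]
    rw [e1]
    simp only [hRv]
    rw [norm_mul, Complex.norm_real, Real.norm_of_nonneg hσ.le,
      Real.mul_rpow hσ.le (norm_nonneg _)]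
    have : σ ^ (2 * (s - 1)) ≠ 0 := (Real.rpow_pos_of_pos hσ _).ne'
    field_simp
  rw [integral_congr_ae (ae_of_all _ hg), integral_const_mul, bp_change R hR0 (fun u : Unit ⊕ m → ℂ =>
    ‖u (Sum.inl ())‖ ^ (2 * (s - 1)) * Real.exp (-∑ i, ‖u i‖ ^ 2)), hRdet]
  have e2 : (σ ^ (2 * (s - 1)))⁻¹ * (x.det.re)⁻¹ =
      x.det.re ^ (-s) * (x.submatrix Sum.inr Sum.inr).det.re ^ (s - 1) := by
    rw [Real.rpow_mul hσ.le, Real.rpow_two,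
      show σ ^ 2 = x.det.re / (x.submatrix Sum.inr Sum.inr).det.re by rw [← hdet]; field_simp,
      Real.div_rpow h2.le h4.le, inv_div, div_eq_mul_inv, ← Real.rpow_neg h2.le,
      ← Real.rpow_neg_one, mul_assoc, ← Real.rpow_add h2, mul_comm]
    congr 2; ring
  rw [← mul_assoc, e2, mul_comm]

lemma bp_main (n : ℕ) : ∀ (s : ℝ), (n : ℝ) - 1 < s → ∀ (p : ℕ)
    (x : Fin p → Matrix (Fin n) (Fin n) ℂ), (∀ i, (x i).PosDef) → ∀ c : Fin p → ℂ,
    0 ≤ ∑ i : Fin p, ∑ j : Fin p, c i * (starRingEnd ℂ) (c j) *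
      (((x i + x j).det.re ^ (-s) : ℝ) : ℂ) := by
  induction n with
  | zero =>
    intro s _ p x hx c
    have : ∑ i : Fin p, ∑ j : Fin p, c i * (starRingEnd ℂ) (c j) *
      (((x i + x j).det.re ^ (-s) : ℝ) : ℂ) = (∑ i, c i) * star (∑ i, c i) := by
      rw [star_sum, Finset.sum_mul_sum]
      simp
    rw [this]
    exact mul_star_self_nonneg _
  | succ n ih =>
    intro s hs p x hx c
    push_cast at hs
    have hs0 : 0 < s := by have : (0:ℝ) ≤ n := n.cast_nonneg
                           linarith
    obtain ⟨C, hC, key⟩ := bp_key (m := Fin n) hs0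
    obtain ⟨e⟩ : Nonempty (Unit ⊕ Fin n ≃ Fin (n + 1)) :=
      ⟨Fintype.equivOfCardEq (by simp [add_comm])⟩
    set X : Fin p → Matrix (Unit ⊕ Fin n) (Unit ⊕ Fin n) ℂ := fun i => (x i).submatrix e e with hX
    have hXp : ∀ i, (X i).PosDef := fun i => (hx i).submatrix e.injective
    set y : Fin p → Matrix (Fin n) (Fin n) ℂ := fun i => (X i).submatrix Sum.inr Sum.inr with hy
    have hyp : ∀ i, (y i).PosDef := fun i => (hXp i).submatrix Sum.inr_injective
    set F : Fin p → (Unit ⊕ Fin n → ℂ) → ℝ := fun i v => Real.exp (-(star v ⬝ᵥ X i *ᵥ v).re)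
    set K : Fin p → Fin p → ℝ := fun i j => (y i + y j).det.re ^ (-(s - 1))
    set w : (Unit ⊕ Fin n → ℂ) → ℝ := fun v => ‖v (Sum.inl ())‖ ^ (2 * (s - 1))
    have hint : ∀ i j, ∫ v, w v * (F i v * F j v) =
        C * ((x i + x j).det.re ^ (-s) * (y i + y j).det.re ^ (s - 1)) := by
      intro i j
      have h := key (X i + X j) ((hXp i).add (hXp j))
      have hd : (X i + X j).det = (x i + x j).det := by
        rw [← det_submatrix_equiv_self e (x i + x j)]; rfl
      rw [hd] at h
      rw [show (y i + y j) = (X i + X j).submatrix Sum.inr Sum.inr from rfl, ← h]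
      refine integral_congr_ae (ae_of_all _ fun v => ?_)
      simp only [w, F, ← Real.exp_add, add_mulVec, dotProduct_add, Complex.add_re, neg_add]
    have hpos1 : ∀ i j, 0 < (x i + x j).det.re := fun i j => (bp_det ((hx i).add (hx j))).2
    have hpos2 : ∀ i j, 0 < (y i + y j).det.re := fun i j => (bp_det ((hyp i).add (hyp j))).2
    have hintg : ∀ i j, Integrable (fun v => w v * (F i v * F j v)) := by
      intro i j
      by_contra hcon
      have h0 := integral_undef hcon
      rw [hint i j] at h0
      have := Real.rpow_pos_of_pos (hpos1 i j) (-s)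
      have := Real.rpow_pos_of_pos (hpos2 i j) (s - 1)
      have : 0 < C * ((x i + x j).det.re ^ (-s) * (y i + y j).det.re ^ (s - 1)) := by positivity
      linarith
    have hval : ∀ i j, (x i + x j).det.re ^ (-s) = C⁻¹ * (K i j * ∫ v, w v * (F i v * F j v)) := by
      intro i j
      rw [hint i j]
      simp only [K]
      rw [Real.rpow_neg (hpos2 i j).le (s - 1)]
      have := Real.rpow_pos_of_pos (hpos2 i j) (s - 1)
      field_simp
    have hterm : ∀ i j, c i * (starRingEnd ℂ) (c j) * (((x i + x j).det.re ^ (-s) : ℝ) : ℂ) =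
        ((C⁻¹ : ℝ) : ℂ) * ∫ v, (c i * (starRingEnd ℂ) (c j) * (K i j : ℂ)) *
          ((w v * (F i v * F j v) : ℝ) : ℂ) := by
      intro i j
      rw [integral_const_mul, integral_complex_ofReal, hval i j]
      push_cast
      ring
    simp_rw [hterm, ← Finset.mul_sum]
    have hI : ∀ i j, Integrable (fun v => (c i * (starRingEnd ℂ) (c j) * (K i j : ℂ)) *
          ((w v * (F i v * F j v) : ℝ) : ℂ)) := fun i j => ((hintg i j).ofReal).const_mul _
    have hsum : ∑ i, ∑ j, ∫ v, (c i * (starRingEnd ℂ) (c j) * (K i j : ℂ)) *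
          ((w v * (F i v * F j v) : ℝ) : ℂ) = ∫ v, ∑ i, ∑ j,
          (c i * (starRingEnd ℂ) (c j) * (K i j : ℂ)) * ((w v * (F i v * F j v) : ℝ) : ℂ) := by
      rw [integral_finsetSum _ fun i _ => integrable_finsetSum _ fun j _ => hI i j]
      refine Finset.sum_congr rfl fun i _ => ?_
      rw [integral_finsetSum _ fun j _ => hI i j]
    rw [hsum]
    refine mul_nonneg (by exact_mod_cast (inv_pos.2 hC).le) (integral_nonneg fun v => ?_)
    have h := ih (s - 1) (by linarith) p y hyp (fun i => c i * (F i v : ℂ))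
    have hw : (0 : ℂ) ≤ (w v : ℂ) := by
      have : 0 ≤ w v := by positivity
      exact_mod_cast this
    refine (mul_nonneg hw h).trans_eq ?_
    simp_rw [Finset.mul_sum]
    refine Finset.sum_congr rfl fun i _ => Finset.sum_congr rfl fun j _ => ?_
    simp only [map_mul, Complex.conj_ofReal, K]
    push_cast
    ring

end BetaPrimeAux

/-- For `n ≥ 1` and real `α > n-1`, the complex Beta-prime kernel
`k_α(x,y) = (det x · det y / det(x+y)²)^α` is positive semidefinite on the cone of complex
Hermitian positive-definite `n×n` matrices. The determinants of Hermitian positive-definite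
matrices are positive reals, so the kernel is the real power `α` of the positive real number
`det(x).re · det(y).re / (det(x+y).re)²` (the order on `ℂ` being the one in which `0 ≤ z` iff
`z` is a nonnegative real number). -/
theorem betaPrime_kernel_posSemidef_complex
    (n : ℕ) (hn : 1 ≤ n) (α : ℝ) (hα : (n : ℝ) - 1 < α) :
    ∀ (p : ℕ), 1 ≤ p → ∀ (x : Fin p → Matrix (Fin n) (Fin n) ℂ),
      (∀ i, (x i).PosDef) → ∀ c : Fin p → ℂ,
        0 ≤ ∑ i : Fin p, ∑ j : Fin p, c i * (starRingEnd ℂ) (c j) *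
          (((((x i).det.re * (x j).det.re) / ((x i + x j).det.re) ^ 2) ^ α : ℝ) : ℂ) := by
  intro p _ x hx c
  have hs : (n : ℝ) - 1 < 2 * α := by
    have : (1 : ℝ) ≤ n := by exact_mod_cast hn
    linarith
  have h := bp_main n (2 * α) hs p x hx (fun i => c i * (((x i).det.re ^ α : ℝ) : ℂ))
  refine h.trans_eq ?_
  refine Finset.sum_congr rfl fun i _ => Finset.sum_congr rfl fun j _ => ?_
  have hi := (bp_det (hx i)).2
  have hj := (bp_det (hx j)).2
  have hij := (bp_det ((hx i).add (hx j))).2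
  have e : (((x i).det.re * (x j).det.re) / ((x i + x j).det.re) ^ 2) ^ α =
      (x i).det.re ^ α * (x j).det.re ^ α * (x i + x j).det.re ^ (-(2 * α)) := by
    rw [Real.div_rpow (by positivity) (by positivity), Real.mul_rpow hi.le hj.le,
      Real.rpow_neg hij.le, Real.rpow_mul hij.le, Real.rpow_two, div_eq_mul_inv]
  rw [e]
  simp only [map_mul, Complex.conj_ofReal]
  push_cast
  ring
end

section
/- Let α > 0 be real and define the one-dimensional Beta-prime kernel k_α(x,y) = (x·y/(x+y)²)^α for x, y ∈ (0,∞). Then k_α is C₀-universal on (0,∞): for every continuous function g : (0,∞) → ℂ vanishing at infinity (i.e. such that for every ε > 0 the set {y ∈ (0,∞) : |g(y)| ≥ ε} is compact in (0,∞)) and every ε > 0, there exist p ≥ 1, points x₁, …, x_p ∈ (0,∞) and coefficients a₁, …, a_p ∈ ℂ such that sup_{y ∈ (0,∞)} |g(y) − ∑_{j=1}^p a_j (x_j·y/(x_j+y)²)^α| < ε. -/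
open Complex Real Finset Set

lemma bp_coeff_mem {E : Type*} [NormedAddCommGroup E] [NormedSpace ℝ E] (W : Submodule ℝ E)
    (hW : IsClosed (W : Set E)) (v : ℕ → E) (F : ℝ → E)
    (hF : ∀ t : ℝ, |t| < 1 → HasSum (fun n => t ^ n • v n) (F t))
    (hFW : ∀ t : ℝ, |t| < 1 → F t ∈ W) (n : ℕ) : v n ∈ W := by
  have : IsClosed (W : Set E) := hW
  let q : E →L[ℝ] E ⧸ W := W.mkQL
  let p : FormalMultilinearSeries ℝ ℝ (E ⧸ W) := fun n =>
    ContinuousMultilinearMap.mkPiRing ℝ (Fin n) (q (v n))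
  have hp : HasFPowerSeriesAt (fun _ : ℝ => (0 : E ⧸ W)) p 0 := by
    rw [hasFPowerSeriesAt_iff]
    filter_upwards [Metric.ball_mem_nhds (0 : ℝ) one_pos] with t ht
    have ht : |t| < 1 := by simpa using ht
    have h := (hF t ht).mapL q
    have h0 : q (F t) = 0 := (Submodule.Quotient.mk_eq_zero W).2 (hFW t ht)
    rw [h0] at h
    simpa [p, FormalMultilinearSeries.coeff] using h
  have h := hp.eq_zero
  have h1 : p.coeff n = 0 := by rw [h]; simp [FormalMultilinearSeries.coeff]
  have h2 : q (v n) = 0 := by simpa [p, FormalMultilinearSeries.coeff] using h1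
  exact (Submodule.Quotient.mk_eq_zero W).1 h2

lemma bp_choose_ne (a : ℝ) (ha : 0 < a) (n : ℕ) : Ring.choose (-a) n ≠ 0 := by
  intro h
  have h1 := Ring.descPochhammer_eq_factorial_smul_choose (-a) n
  rw [h, smul_zero] at h1
  have h2 : ∀ m : ℕ, (descPochhammer ℤ m).smeval (-a) ≠ 0 := by
    intro m
    induction m with
    | zero => simp
    | succ m ih =>
      rw [descPochhammer_succ_right, Polynomial.smeval_mul]
      refine mul_ne_zero ih ?_
      simp only [Polynomial.smeval_sub, Polynomial.smeval_X, Polynomial.smeval_natCast, pow_one,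
        pow_zero, nsmul_eq_mul, mul_one]
      have : (0 : ℝ) ≤ m := Nat.cast_nonneg m
      linarith
  exact h2 n h1

open unitInterval in
noncomputable def bpE (n : ℕ) : C(I, ℝ) := ⟨fun u => (u : ℝ) ^ n, by fun_prop⟩

open unitInterval in
lemma bp_pos {t : ℝ} (ht : |t| < 1) (u : I) : 0 < 1 + t * (u : ℝ) := by
  have := u.2.1; have := u.2.2; have := abs_lt.1 ht
  nlinarith

open unitInterval in
lemma bp_real_top (a : ℝ) (ha : 0 < a) (W : Submodule ℝ C(I, ℝ))
    (hW : IsClosed (W : Set C(I, ℝ))) 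
    (hF : ∀ t : ℝ, |t| < 1 → ∀ f : C(I, ℝ), (∀ u : I, f u = (1 + t * (u : ℝ)) ^ (-a)) → f ∈ W) :
    W = ⊤ := by
  have hsum : ∀ t : ℝ, |t| < 1 → Summable (fun n => t ^ n • (Ring.choose (-a) n • bpE n)) := by
    intro t ht
    have h := (binomialSeries ℝ (-a)).summable_norm_mul_pow (r := ‖t‖₊) 
      (lt_of_lt_of_le (by rw [← Real.norm_eq_abs] at ht; exact_mod_cast ht) binomialSeries_radius_ge_one)
    refine Summable.of_norm_bounded h fun n => ?_
    have he : ‖bpE n‖ ≤ 1 := by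
      rw [ContinuousMap.norm_le _ zero_le_one]
      intro u
      simp only [bpE, ContinuousMap.coe_mk, norm_pow]
      exact pow_le_one₀ (norm_nonneg _) (by rw [Real.norm_eq_abs, abs_of_nonneg u.2.1]; exact u.2.2)
    have hc : ‖binomialSeries ℝ (-a) n‖ = ‖Ring.choose (-a) n‖ := by
      rw [binomialSeries, FormalMultilinearSeries.ofScalars_norm]
    rw [hc, norm_smul, norm_smul, norm_pow, coe_nnnorm]
    calc _ ≤ ‖t‖ ^ n * (‖Ring.choose (-a) n‖ * 1) := by gcongr
      _ = _ := by ring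
  have hmem : ∀ n, bpE n ∈ W := by
    intro n
    have := bp_coeff_mem W hW (fun n => Ring.choose (-a) n • bpE n) 
      (fun t => ∑' n, t ^ n • (Ring.choose (-a) n • bpE n)) (fun t ht => (hsum t ht).hasSum) 
      (fun t ht => hF t ht _ fun u => ?_) n
    · exact (W.smul_mem_iff (bp_choose_ne a ha n)).1 this
    · have h1 := (hsum t ht).hasSum.mapL (ContinuousMap.evalCLM ℝ u)
      have htu : |t * (u:ℝ)| < 1 := by
        rw [abs_mul, abs_of_nonneg u.2.1]
        nlinarith [u.2.2, abs_nonneg t, u.2.1]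
      have h2 := (Real.one_add_rpow_hasFPowerSeriesOnBall_zero (a := -a)).hasSum (y := t * (u:ℝ)) 
        (by rw [← ENNReal.ofReal_one, Metric.eball_ofReal]; simpa using htu)
      rw [zero_add] at h2
      refine HasSum.unique h1 ?_
      refine (congrArg (fun q : ℕ → ℝ => HasSum q ((1 + t * (u : ℝ)) ^ (-a)))
        (funext fun m => ?_)).mpr h2
      rw [binomialSeries_apply]
      simp only [map_smul, ContinuousMap.evalCLM_apply, bpE, ContinuousMap.coe_mk, smul_eq_mul,
        List.ofFn_const, List.prod_replicate, mul_pow]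
      ring
  rw [eq_top_iff]
  intro f _
  have hf : f ∈ (polynomialFunctions I).topologicalClosure := by
    rw [polynomialFunctions_closure_eq_top']; trivial
  have hsub : ((polynomialFunctions I : Subalgebra ℝ C(I, ℝ)) : Set C(I, ℝ)) ⊆ W := by
    rw [polynomialFunctions_coe]
    rintro _ ⟨P, rfl⟩
    induction P using Polynomial.induction_on' with
    | add p q hp hq => rw [map_add]; exact W.add_mem hp hq
    | monomial n c => 
      have : (Polynomial.toContinuousMapOnAlgHom I) ((Polynomial.monomial n) c) = c • bpE n := by
        ext u
        simp [bpE]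
      rw [this]
      exact W.smul_mem c (hmem n)
  exact closure_minimal hsub hW hf

open unitInterval in
noncomputable def bpF (a : ℝ) (t : {t : ℝ // |t| < 1}) : C(I, ℂ) := 
  ⟨fun u => (((1 + (t : ℝ) * (u : ℝ)) ^ (-a) : ℝ) : ℂ), by
    refine Complex.continuous_ofReal.comp (Continuous.rpow_const (by fun_prop) fun u => Or.inl (bp_pos t.2 u).ne')⟩

open unitInterval in
lemma bp_dense (a : ℝ) (ha : 0 < a) (f : C(I, ℂ)) : 
    f ∈ closure (Submodule.span ℂ (Set.range (bpF a)) : Set C(I, ℂ)) := by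
  let V := (Submodule.span ℂ (Set.range (bpF a))).topologicalClosure
  let L : C(I, ℝ) →L[ℝ] C(I, ℂ) := Complex.ofRealCLM.compLeftContinuous ℝ I
  have hW := bp_real_top a ha ((V.restrictScalars ℝ).comap L.toLinearMap) 
    (by 
      have : IsClosed (V : Set C(I, ℂ)) := Submodule.isClosed_topologicalClosure _
      exact this.preimage L.continuous)
    (by
      intro t ht f hf
      refine subset_closure (Submodule.subset_span ⟨⟨t, ht⟩, ?_⟩)
      ext u
      simp [bpF, L, hf])
  have hL : ∀ r : C(I, ℝ), L r ∈ V := by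
    intro r
    have : r ∈ ((V.restrictScalars ℝ).comap L.toLinearMap) := by rw [hW]; trivial
    exact this
  change f ∈ V
  have : f = L ⟨fun u => (f u).re, by fun_prop⟩ + Complex.I • L ⟨fun u => (f u).im, by fun_prop⟩ := by
    ext u
    simp [L, mul_comm Complex.I, Complex.re_add_im]
  rw [this]
  exact V.add_mem (hL _) (V.smul_mem _ (hL _))

/-- The transported function on `[0,1]`. -/
noncomputable def bpG (g : ℝ → ℂ) (u : ℝ) : ℂ :=
  open Classical in if u ∈ Ioo (0 : ℝ) 1 then g (1 / u - 1) else 0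

lemma bpG_continuous (g : ℝ → ℂ) (hg : ContinuousOn g (Ioi (0 : ℝ)))
    (hg0 : ∀ ε : ℝ, 0 < ε →
      IsCompact {y : ℝ | y ∈ Ioi (0 : ℝ) ∧ ε ≤ ‖g y‖}) : Continuous (bpG g) := by
  rw [continuous_iff_continuousAt]
  intro u
  by_cases hu : u ∈ Ioo (0 : ℝ) 1
  · have h1 : ContinuousAt (fun v : ℝ => g (1 / v - 1)) u := by
      have hpos : 0 < 1 / u - 1 := by
        have := (one_lt_div hu.1).2 hu.2
        linarith
      refine ContinuousAt.comp (f := fun v : ℝ => 1 / v - 1) (hg.continuousAt (Ioi_mem_nhds hpos)) ?_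
      exact (continuousAt_const.div continuousAt_id hu.1.ne').sub continuousAt_const
    refine h1.congr ?_
    filter_upwards [isOpen_Ioo.mem_nhds hu] with v hv
    simp [bpG, hv.1, hv.2]
  · have h0 : bpG g u = 0 := by simp only [bpG, if_neg hu]
    rw [ContinuousAt, h0, Metric.tendsto_nhds]
    intro ε hε
    have hA := hg0 ε hε
    have hB : IsClosed ((fun y : ℝ => 1 / (1 + y)) '' {y : ℝ | y ∈ Ioi (0 : ℝ) ∧ ε ≤ ‖g y‖}) := by
      refine (hA.image_of_continuousOn ?_).isClosed
      refine continuousOn_const.div (by fun_prop) ?_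
      rintro y ⟨hy, -⟩
      have : 0 < y := hy
      positivity
    have hnot : u ∈ ((fun y : ℝ => 1 / (1 + y)) '' {y : ℝ | y ∈ Ioi (0 : ℝ) ∧ ε ≤ ‖g y‖})ᶜ := by
      rintro ⟨y, ⟨hy, -⟩, rfl⟩
      have hy : 0 < y := hy
      refine hu ⟨by positivity, ?_⟩
      rw [div_lt_one (by positivity)]
      linarith
    filter_upwards [hB.isOpen_compl.mem_nhds hnot] with v hv
    by_cases hv' : v ∈ Ioo (0 : ℝ) 1
    · rw [dist_zero_right]
      by_contra hcon
      refine hv ⟨1 / v - 1, ⟨?_, ?_⟩, ?_⟩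
      · have := (one_lt_div hv'.1).2 hv'.2
        simp only [Set.mem_Ioi]
        linarith
      · simpa only [bpG, if_pos hv', not_lt] using hcon
      · simp
    · simp only [bpG, if_neg hv', dist_self]
      exact hε

open unitInterval in
/-- The weight `(u(1-u))^α`. -/
noncomputable def bpW (α : ℝ) (hα : 0 < α) : C(I, ℂ) :=
  ⟨fun u => ((((u : ℝ) * (1 - (u : ℝ))) ^ α : ℝ) : ℂ), by
    refine Complex.continuous_ofReal.comp
      (Continuous.rpow_const (by fun_prop) fun u => Or.inr hα.le)⟩

open unitInterval in
lemma bp_weight (α : ℝ) (hα : 0 < α) (G : C(I, ℂ))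
    (hG : ∀ u : I, (u : ℝ) ∉ Ioo (0 : ℝ) 1 → G u = 0) (ε : ℝ) (hε : 0 < ε) :
    ∃ h : C(I, ℂ), ‖G - h * bpW α hα‖ < ε := by
  have h1 : G ∈ (Ideal.span {bpW α hα}).closure := by
    rw [← ContinuousMap.idealOfSet_ofIdeal_eq_closure, ContinuousMap.mem_idealOfSet]
    intro u hu
    apply hG
    intro hu'
    apply hu
    rw [ContinuousMap.mem_setOfIdeal]
    refine ⟨bpW α hα, Ideal.mem_span_singleton_self _, ?_⟩
    have : 0 < ((u : ℝ) * (1 - (u : ℝ))) ^ α :=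
      Real.rpow_pos_of_pos (mul_pos hu'.1 (by linarith [hu'.2])) _
    simp only [bpW, ContinuousMap.coe_mk, ne_eq, Complex.ofReal_eq_zero]
    exact this.ne'
  have h2 : G ∈ closure ((Ideal.span {bpW α hα} : Ideal C(I, ℂ)) : Set C(I, ℂ)) := h1
  obtain ⟨f, hf, hd⟩ := Metric.mem_closure_iff.1 h2 ε hε
  obtain ⟨h, rfl⟩ := Ideal.mem_span_singleton'.1 hf
  exact ⟨h, by rwa [dist_eq_norm] at hd⟩

lemma bp_identity (α : ℝ) (t y : ℝ) (ht : |t| < 1) (hy : 0 < y) :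
    ((1 + t) * y / ((1 + t) + y) ^ 2) ^ α =
      (1 + t) ^ α * ((1 + t * (1 / (1 + y))) ^ (-(2 * α)) *
        ((1 / (1 + y)) * (1 - 1 / (1 + y))) ^ α) := by
  have hx : 0 < 1 + t := by linarith [(abs_lt.1 ht).1]
  have hs : 1 + t * (1 / (1 + y)) = (1 + t + y) / (1 + y) := by field_simp; ring
  have hw : (1 / (1 + y)) * (1 - 1 / (1 + y)) = y / (1 + y) ^ 2 := by field_simp; ring
  have hp : 0 < (1 + t + y) / (1 + y) := by positivity
  rw [hs, hw, show -(2 * α) = (-2) * α by ring, Real.rpow_mul hp.le,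
    ← Real.mul_rpow (by positivity) (by positivity), ← Real.mul_rpow hx.le (by positivity)]
  congr 1
  rw [Real.rpow_neg hp.le, Real.rpow_ofNat]
  field_simp

/-- For real `α > 0`, the one-dimensional Beta-prime kernel
`k_α(x,y) = (xy/(x+y)²)^α` on the cone `(0,∞)` is `C₀`-universal: every continuous
`g : (0,∞) → ℂ` vanishing at infinity (i.e. each superlevel set `{y ∈ (0,∞) : ε ≤ |g y|}` is a
compact subset of `(0,∞)`) can be approximated uniformly on `(0,∞)`, to any accuracy `ε > 0`,
by finite complex linear combinations of sections `k_α(x_j, ·)` with `x_j ∈ (0,∞)`. -/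
theorem betaPrime_kernel_one_dim_C0_universal
    (α : ℝ) (hα : 0 < α)
    (g : ℝ → ℂ) (hg : ContinuousOn g (Ioi (0 : ℝ)))
    (hg0 : ∀ ε : ℝ, 0 < ε →
      IsCompact {y : ℝ | y ∈ Ioi (0 : ℝ) ∧ ε ≤ ‖g y‖} ∧
        {y : ℝ | y ∈ Ioi (0 : ℝ) ∧ ε ≤ ‖g y‖} ⊆ Ioi (0 : ℝ)) :
    ∀ ε : ℝ, 0 < ε →
      ∃ (p : ℕ) (_ : 1 ≤ p) (x : Fin p → ℝ) (_ : ∀ j, x j ∈ Ioi (0 : ℝ)) (a : Fin p → ℂ),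
        ∀ y ∈ Ioi (0 : ℝ),
          ‖g y - ∑ j : Fin p, a j * (((x j * y / (x j + y) ^ 2) ^ α : ℝ) : ℂ)‖ < ε := by
  intro ε hε
  let G : C(unitInterval, ℂ) := ⟨fun u => bpG g u,
    (bpG_continuous g hg fun ε hε => (hg0 ε hε).1).comp continuous_subtype_val⟩
  obtain ⟨h, hh⟩ := bp_weight α hα G
    (fun u hu => by simp only [G, ContinuousMap.coe_mk, bpG, if_neg hu]) (ε / 2) (by positivity)
  have hw : 0 < ‖bpW α hα‖ + 1 := by positivity
  obtain ⟨f, hf, hd⟩ := Metric.mem_closure_iff.1 (bp_dense (2 * α) (by positivity) h)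
    (ε / 2 / (‖bpW α hα‖ + 1)) (by positivity)
  rw [dist_eq_norm, lt_div_iff₀ hw] at hd
  have hGf : ‖G - f * bpW α hα‖ < ε := by
    calc ‖G - f * bpW α hα‖ = ‖(G - h * bpW α hα) + (h - f) * bpW α hα‖ := by congr 1; ring
      _ ≤ ‖G - h * bpW α hα‖ + ‖h - f‖ * ‖bpW α hα‖ :=
        (norm_add_le _ _).trans (add_le_add le_rfl (norm_mul_le _ _))
      _ < ε := by nlinarith [norm_nonneg (h - f)]
  obtain ⟨n, c, F, rfl⟩ := Submodule.mem_span_set'.1 hf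
  choose t ht using fun i => (F i).2
  have hx : ∀ i, 0 < 1 + (t i : ℝ) := fun i => by linarith [(abs_lt.1 (t i).2).1]
  refine ⟨n + 1, by omega, Fin.cons 1 (fun i => 1 + (t i : ℝ)), ?_,
    Fin.cons 0 (fun i => c i * ((((1 + (t i : ℝ)) ^ α)⁻¹ : ℝ) : ℂ)), ?_⟩
  · intro j
    refine Fin.cases ?_ (fun i => ?_) j
    · simp
    · simpa using hx i
  · intro y hy
    have hy : 0 < y := hy
    have hu0 : 0 < 1 / (1 + y) := by positivity
    have hu1 : 1 / (1 + y) < 1 := by rw [div_lt_one (by positivity)]; linarith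
    let u : unitInterval := ⟨1 / (1 + y), hu0.le, hu1.le⟩
    have hGu : G u = g y := by
      simp only [G, ContinuousMap.coe_mk, bpG, u, if_pos (show 1 / (1 + y) ∈ Ioo (0 : ℝ) 1 from ⟨hu0, hu1⟩)]
      congr 1
      field_simp
      ring
    refine lt_of_le_of_lt ?_ hGf
    refine le_trans (le_of_eq ?_) (ContinuousMap.norm_coe_le_norm _ u)
    congr 1
    rw [ContinuousMap.sub_apply, hGu, ContinuousMap.mul_apply, ContinuousMap.sum_apply,
      Finset.sum_mul, Fin.sum_univ_succ]
    simp only [Fin.cons_zero, Fin.cons_succ, zero_mul, zero_add]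
    congr 1
    refine Finset.sum_congr rfl fun i _ => ?_
    rw [bp_identity α (t i) y (t i).2 hy, ← ht i]
    have hne : (((1 + (t i : ℝ)) ^ α : ℝ) : ℂ) ≠ 0 := by
      exact_mod_cast (Real.rpow_pos_of_pos (hx i) α).ne'
    simp only [ContinuousMap.smul_apply, bpF, bpW, ContinuousMap.coe_mk, u, smul_eq_mul]
    push_cast
    field_simp
end
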